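/- arXiv:0802.0264 — 8 statements merged into one kernel-verified Lean document; each statement's English description precedes it below -/
import Mathlib

section
/- Let q < 3 and let f : ℝ → [0,∞) be measurable such that for every ξ ∈ ℝ the function x ↦ f(x)·e_q^{i x ξ f(x)^{q-1}} is integrable on {x : f(x) > 0}. Then for all constants a > 0, b > 0 and all ξ ∈ ℝ: (1) F_q[a·f](ξ) = a·F_q[f](ξ / a^{1-q}); (2) F_q[f(b·)](ξ) = (1/b)·F_q[f](ξ / b). -/
open MeasureTheory Complex Real Set Filter

noncomputable section

/-- The complex `q`-exponential: principal branch of `(1+(1-q)z)^{1/(1-q)}`,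
set to `0` when `1+(1-q)z` is a nonpositive real; `exp z` for `q = 1`. -/
def qExp (q : ℝ) (z : ℂ) : ℂ :=
  if q = 1 then Complex.exp z
  else if (1 + (1 - q) * z).im = 0 ∧ (1 + (1 - q) * z).re ≤ 0 then 0
  else (1 + (1 - q) * z) ^ ((1 : ℂ) / (1 - q))

/-- The real `q`-exponential: `(1+(1-q)z)^{1/(1-q)}` when `1+(1-q)z > 0`,
`0` when `1+(1-q)z ≤ 0`; `exp z` for `q = 1`. -/
def qExpR (q z : ℝ) : ℝ :=
  if q = 1 then Real.exp z
  else if 1 + (1 - q) * z ≤ 0 then 0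
  else (1 + (1 - q) * z) ^ ((1 : ℝ) / (1 - q))

/-- The `q`-Fourier transform of a nonnegative function `f` on `ℝ`:
`F_q[f](ξ) = ∫_{{x : f x > 0}} f(x) · e_q^{i x ξ f(x)^{q-1}} dx`. -/
def qFourier (q : ℝ) (f : ℝ → ℝ) (ξ : ℝ) : ℂ :=
  ∫ x in {x : ℝ | 0 < f x},
    (f x : ℂ) * qExp q (Complex.I * (x : ℂ) * (ξ : ℂ) * ((f x ^ (q - 1) : ℝ) : ℂ))

/-- Homogeneity: `F_q[a f](ξ) = a F_q[f](ξ / a^{1-q})` for `a > 0`. -/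
theorem qFourier_const_mul (q : ℝ) {f : ℝ → ℝ} (hf : Measurable f) {a : ℝ} (ha : 0 < a) (ξ : ℝ) :
    qFourier q (fun x => a * f x) ξ = (a : ℂ) * qFourier q f (ξ / a ^ (1 - q)) := by
  have hset : {x : ℝ | 0 < a * f x} = {x : ℝ | 0 < f x} := by
    ext x
    simp [ha]
  unfold qFourier
  rw [hset, ← integral_const_mul]
  refine setIntegral_congr_fun (measurableSet_lt measurable_const hf) fun x hx => ?_
  have hscale : ξ * (a * f x) ^ (q - 1) = ξ / a ^ (1 - q) * f x ^ (q - 1) := by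
    rw [Real.mul_rpow ha.le (le_of_lt hx), ← neg_sub 1 q, Real.rpow_neg ha.le]
    ring
  simp only [mul_assoc, ← Complex.ofReal_mul, hscale]
  push_cast
  ring

/-- Dilation: `F_q[f(b·)](ξ) = (1/b) F_q[f](ξ / b)` for `b > 0`. -/
theorem qFourier_comp_mul_left (q : ℝ) {f : ℝ → ℝ} (hf : Measurable f) {b : ℝ} (hb : 0 < b)
    (ξ : ℝ) :
    qFourier q (fun x => f (b * x)) ξ = (1 / (b : ℂ)) * qFourier q f (ξ / b) := by
  have hb' : (b : ℂ) ≠ 0 := by exact_mod_cast hb.ne'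
  have hmeas : MeasurableSet {x : ℝ | 0 < f x} := measurableSet_lt measurable_const hf
  have hmeas' : MeasurableSet {x : ℝ | 0 < f (b * x)} := hmeas.preimage (measurable_const_mul b)
  unfold qFourier
  rw [← integral_indicator hmeas, ← integral_indicator hmeas']
  have hsub := Measure.integral_comp_mul_left ({x : ℝ | 0 < f x}.indicator fun x : ℝ =>
    (f x : ℂ) * qExp q (Complex.I * (x : ℂ) * ((ξ / b : ℝ) : ℂ) * ((f x ^ (q - 1) : ℝ) : ℂ))) b
  rw [abs_of_pos (inv_pos.2 hb), Complex.real_smul, Complex.ofReal_inv, ← one_div] at hsub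
  rw [← hsub]
  congr 1 with x
  have harg : Complex.I * ((b * x : ℝ) : ℂ) * ((ξ / b : ℝ) : ℂ) = Complex.I * x * ξ := by
    push_cast
    field_simp
  simp only [Set.indicator_apply, Set.mem_ofPred_eq, harg]

/-- basic scaling properties of the `q`-Fourier transform. -/
theorem qFourier_scaling (q : ℝ) (hq : q < 3) (f : ℝ → ℝ) (hf : Measurable f)
    (hf0 : ∀ x, 0 ≤ f x)
    (hint : ∀ ξ : ℝ, IntegrableOn
      (fun x : ℝ => (f x : ℂ) * qExp q (Complex.I * (x : ℂ) * (ξ : ℂ) * ((f x ^ (q - 1) : ℝ) : ℂ)))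
      {x : ℝ | 0 < f x})
    (a b : ℝ) (ha : 0 < a) (hb : 0 < b) (ξ : ℝ) :
    qFourier q (fun x => a * f x) ξ = (a : ℂ) * qFourier q f (ξ / a ^ (1 - q)) ∧
    qFourier q (fun x => f (b * x)) ξ = (1 / (b : ℂ)) * qFourier q f (ξ / b) := by
  exact ⟨qFourier_const_mul q hf ha ξ, qFourier_comp_mul_left q hf hb ξ⟩

end
end

section
/- Let 1 ≤ q < 3 and β > 0. Then for every ξ ∈ ℝ, F_q[G_q(β;·)](ξ) = e_{q'}^{-β₊ ξ²}, where q' = (1+q)/(3-q) and β₊ = (3-q) / (8 β^{2-q} C_q^{2(q-1)}). -/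
open MeasureTheory Complex Real Set Filter

noncomputable section

/-- The normalizing constant `C_q = ∫_ℝ e_q^{-x²} dx`. -/
def Cq (q : ℝ) : ℝ := ∫ x : ℝ, qExpR q (-x ^ 2)

/-- The `q`-Gaussian `G_q(β; x) = (√β / C_q) e_q^{-β x²}`. -/
def qGaussian (q β x : ℝ) : ℝ := (Real.sqrt β / Cq q) * qExpR q (-β * x ^ 2)

/-- Shifting the contour of integration from the real line to the line `Im z = η`. -/
theorem integral_add_mul_I_eq_integral_ofReal {f : ℂ → ℂ} {b : ℝ → ℝ} {η : ℝ}
    (hd : ∀ z : ℂ, z.im ∈ uIcc 0 η → DifferentiableAt ℂ f z)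
    (hb : ∀ z : ℂ, z.im ∈ uIcc 0 η → ‖f z‖ ≤ b z.re) (hbi : Integrable b)
    (hb0 : Tendsto b (cocompact ℝ) (nhds 0)) :
    ∫ x : ℝ, f (x + η * I) = ∫ x : ℝ, f x := by
  have integrable_line : ∀ y ∈ uIcc 0 η, Integrable fun x : ℝ => f (x + y * I) := by
    intro y hy
    have hc : Continuous fun x : ℝ => f (x + y * I) := by
      refine continuous_iff_continuousAt.2 fun x => ?_
      have hf : ContinuousAt f (x + y * I) := (hd _ (by simpa using hy)).continuousAt
      exact ContinuousAt.comp (f := fun x : ℝ => (x : ℂ) + y * I) hf (by fun_prop)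
    refine hbi.mono' hc.aestronglyMeasurable (ae_of_all _ fun x => ?_)
    simpa using hb (x + y * I) (by simpa using hy)
  have tendsto_line : ∀ y ∈ uIcc 0 η, Tendsto (fun T : ℝ => ∫ x in -T..T, f (x + y * I)) atTop
      (nhds (∫ x : ℝ, f (x + y * I))) := fun y hy =>
    intervalIntegral_tendsto_integral (integrable_line y hy) tendsto_neg_atTop_atBot tendsto_id
  have tendsto_side : ∀ {l : Filter ℝ}, l ≤ cocompact ℝ →
      Tendsto (fun T : ℝ => I • ∫ y in (0 : ℝ)..η, f (T + y * I)) l (nhds 0) := by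
    intro l hl
    refine squeeze_zero_norm (a := fun T => b T * |η - 0|) (fun T => ?_) ?_
    · rw [norm_smul, norm_I, one_mul]
      refine intervalIntegral.norm_integral_le_of_norm_le_const fun y hy => ?_
      simpa using hb (T + y * I) (by simpa using uIoc_subset_uIcc hy)
    · simpa using (hb0.mono_left hl).mul_const |η - 0|
  have hrect : ∀ T : ℝ, ((∫ x in -T..T, f (x + (0 : ℝ) * I)) - (∫ x in -T..T, f (x + η * I))
      + I • ∫ y in (0 : ℝ)..η, f (T + y * I))
      - I • (∫ y in (0 : ℝ)..η, f ((-T : ℝ) + y * I)) = 0 := by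
    intro T
    have h := integral_boundary_rect_eq_zero_of_differentiableOn f ((-T : ℝ) : ℂ) (T + η * I)
      fun z hz => (hd z (by simpa using (mem_reProdIm.1 hz).2)).differentiableWithinAt
    simpa using h
  have hlim := (((tendsto_line 0 left_mem_uIcc).sub (tendsto_line η right_mem_uIcc)).add
    (tendsto_side atTop_le_cocompact)).sub
    ((tendsto_side atBot_le_cocompact).comp tendsto_neg_atTop_atBot)
  have h0 := tendsto_nhds_unique hlim (tendsto_const_nhds.congr fun T => (hrect T).symm)
  simp only [ofReal_zero, zero_mul, add_zero, sub_zero] at h0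
  exact (sub_eq_zero.1 h0).symm

theorem one_le_one_add_mul_sq {c : ℝ} (hc : 0 < c) (x : ℝ) : 1 ≤ 1 + c * x ^ 2 :=
  le_add_of_nonneg_right (by positivity)

theorem integrable_one_add_mul_sq_rpow_neg {a c : ℝ} (ha : 1 / 2 < a) (hc : 0 < c) :
    Integrable fun x : ℝ => (1 + c * x ^ 2) ^ (-a) := by
  have h := (integrable_rpow_neg_one_add_norm_sq (E := ℝ) (μ := volume) (r := 2 * a)
    (by simp; linarith)).comp_mul_left' (Real.sqrt_pos.2 hc).ne'
  refine h.congr (ae_of_all _ fun x => ?_)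
  simp only [Real.norm_eq_abs, sq_abs, mul_pow, Real.sq_sqrt hc.le]
  congr 1
  ring

theorem integral_one_add_mul_sq_rpow_neg_pos {a c : ℝ} (ha : 1 / 2 < a) (hc : 0 < c) :
    0 < ∫ x : ℝ, (1 + c * x ^ 2) ^ (-a) := by
  have hpos : ∀ x : ℝ, 0 < 1 + c * x ^ 2 := fun x =>
    one_pos.trans_le (one_le_one_add_mul_sq hc x)
  refine integral_pos_of_integrable_nonneg_nonzero (x := 0) ?_
    (integrable_one_add_mul_sq_rpow_neg ha hc) (fun x => (rpow_pos_of_pos (hpos x) _).le)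
    (rpow_pos_of_pos (hpos 0) _).ne'
  exact Continuous.rpow_const (by fun_prop) fun x => Or.inl (hpos x).ne'

theorem tendsto_one_add_mul_sq_rpow_neg {a c : ℝ} (ha : 0 < a) (hc : 0 < c) :
    Tendsto (fun x : ℝ => (1 + c * x ^ 2) ^ (-a)) (cocompact ℝ) (nhds 0) := by
  refine (tendsto_rpow_neg_atTop ha).comp (tendsto_atTop_add_const_left _ _ ?_)
  refine Tendsto.const_mul_atTop hc ?_
  have h := (tendsto_pow_atTop (two_ne_zero)).comp (tendsto_norm_cocompact_atTop (E := ℝ))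
  exact h.congr fun x => by simp

/-- The integral of `(1 + c η² + c z²)^{-a}` over the line `Im z = η` equals the integral over
the real line. -/
theorem integral_add_mul_sq_cpow_neg {a c : ℝ} (ha : 1 / 2 < a) (hc : 0 < c) (η : ℝ) :
    ∫ x : ℝ, (((1 + c * η ^ 2 : ℝ) : ℂ) + c * (x + η * I) ^ 2) ^ ((-a : ℝ) : ℂ) =
      ((∫ x : ℝ, (1 + c * η ^ 2 + c * x ^ 2) ^ (-a) : ℝ) : ℂ) := by
  have hre : ∀ z : ℂ, z.im ∈ uIcc 0 η →
      1 + c * z.re ^ 2 ≤ (((1 + c * η ^ 2 : ℝ) : ℂ) + c * z ^ 2).re := by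
    intro z hz
    have hsq : z.im ^ 2 ≤ η ^ 2 := by
      refine sq_le_sq.2 ?_
      simpa using abs_sub_left_of_mem_uIcc hz
    have : (((1 + c * η ^ 2 : ℝ) : ℂ) + c * z ^ 2).re
        = 1 + c * z.re ^ 2 + c * (η ^ 2 - z.im ^ 2) := by
      rw [add_re, ofReal_re, re_ofReal_mul, sq z, mul_re]
      ring
    rw [this]
    exact le_add_of_nonneg_right (mul_nonneg hc.le (sub_nonneg.2 hsq))
  have h := integral_add_mul_I_eq_integral_ofReal (η := η)
    (f := fun z => (((1 + c * η ^ 2 : ℝ) : ℂ) + c * z ^ 2) ^ ((-a : ℝ) : ℂ))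
    (b := fun x => (1 + c * x ^ 2) ^ (-a)) ?_ ?_
    (integrable_one_add_mul_sq_rpow_neg ha hc)
    (tendsto_one_add_mul_sq_rpow_neg (by linarith) hc)
  · rw [h, ← integral_complex_ofReal]
    refine integral_congr_ae (ae_of_all _ fun x => ?_)
    simp only
    rw [ofReal_cpow (by positivity)]
    push_cast
    rfl
  · intro z hz
    refine DifferentiableAt.cpow_const (by fun_prop) (Or.inl ?_)
    exact one_pos.trans_le ((one_le_one_add_mul_sq hc _).trans (hre z hz))
  · intro z hz
    rw [norm_cpow_real]
    exact rpow_le_rpow_of_nonpos (one_pos.trans_le (one_le_one_add_mul_sq hc _))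
      ((hre z hz).trans (re_le_norm _)) (by linarith)

theorem integral_add_mul_sq_rpow_neg {a p β D : ℝ} (hβ : 0 < β) (hD : 0 < D) (hp : 0 < p) :
    ∫ x : ℝ, (D + p * β * x ^ 2) ^ (-a) =
      D ^ (1 / 2 - a) / √β * ∫ x : ℝ, (1 + p * x ^ 2) ^ (-a) := by
  have h := Measure.integral_comp_mul_left (fun x : ℝ => (1 + p * x ^ 2) ^ (-a)) √(β / D)
  have hfac : ∀ x : ℝ, (D + p * β * x ^ 2) ^ (-a)
      = D ^ (-a) * (1 + p * (√(β / D) * x) ^ 2) ^ (-a) := by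
    intro x
    rw [← Real.mul_rpow hD.le (by positivity), mul_pow, Real.sq_sqrt (by positivity)]
    congr 1
    field_simp
  simp_rw [hfac]
  rw [integral_const_mul, h, abs_of_nonneg (by positivity), smul_eq_mul, ← mul_assoc]
  congr 1
  rw [Real.sqrt_div hβ.le, inv_div, ← mul_div_assoc, Real.sqrt_eq_rpow D,
    ← Real.rpow_add hD, neg_add_eq_sub]

theorem ofReal_mul_cpow_of_pos {r : ℝ} (hr : 0 < r) {z : ℂ} (hz : z ≠ 0) (w : ℂ) :
    (r * z) ^ w = (r : ℂ) ^ w * z ^ w := by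
  have hr' : (r : ℂ) ≠ 0 := ofReal_ne_zero.2 hr.ne'
  rw [cpow_def_of_ne_zero (mul_ne_zero hr' hz), cpow_def_of_ne_zero hr', cpow_def_of_ne_zero hz,
    log_ofReal_mul hr hz, ofReal_log hr.le, add_mul, Complex.exp_add]

theorem qExpR_neg_mul_sq {q : ℝ} (hq : 1 < q) {β : ℝ} (hβ : 0 < β) (x : ℝ) :
    qExpR q (-β * x ^ 2) = (1 + (q - 1) * β * x ^ 2) ^ (-(1 / (q - 1))) := by
  have hp : 0 < q - 1 := sub_pos.2 hq
  have hS : 1 + (1 - q) * (-β * x ^ 2) = 1 + (q - 1) * β * x ^ 2 := by ring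
  rw [qExpR, if_neg hq.ne', hS, if_neg (not_le.2 (by positivity)), ← one_div_neg_eq_neg_one_div,
    neg_sub]

theorem Cq_eq_integral {q : ℝ} (hq : 1 < q) :
    Cq q = ∫ x : ℝ, (1 + (q - 1) * x ^ 2) ^ (-(1 / (q - 1))) := by
  refine integral_congr_ae (ae_of_all _ fun x => ?_)
  simpa using qExpR_neg_mul_sq hq one_pos x

theorem half_lt_one_div_sub_one {q : ℝ} (hq1 : 1 < q) (hq3 : q < 3) : 1 / 2 < 1 / (q - 1) :=
  one_div_lt_one_div_of_lt (sub_pos.2 hq1) (by linarith)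

theorem Cq_pos {q : ℝ} (hq1 : 1 < q) (hq3 : q < 3) : 0 < Cq q := by
  rw [Cq_eq_integral hq1]
  exact integral_one_add_mul_sq_rpow_neg_pos (half_lt_one_div_sub_one hq1 hq3) (sub_pos.2 hq1)

theorem qExp_I_mul {q : ℝ} (hq : q ≠ 1) (t : ℝ) :
    qExp q (I * t) = (1 - (q - 1) * t * I) ^ ((-(1 / (q - 1)) : ℝ) : ℂ) := by
  have hz : 1 + (1 - (q : ℂ)) * (I * t) = 1 - (q - 1) * t * I := by ring
  have hre : (1 - ((q : ℂ) - 1) * t * I).re = 1 := by simp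
  rw [qExp, if_neg hq, hz, if_neg (by rw [hre]; norm_num), ← one_div_neg_eq_neg_one_div, neg_sub]
  push_cast
  rfl

/-- Completing the square in the integrand of the `q`-Fourier transform of a `q`-Gaussian. -/
theorem mul_qExp_I_mul_eq {q : ℝ} (hq : 1 < q) {A β : ℝ} (hA : 0 < A) (hβ : 0 < β) (x ξ : ℝ) :
    ((A * (1 + (q - 1) * β * x ^ 2) ^ (-(1 / (q - 1))) : ℝ) : ℂ) *
        qExp q (I * x * ξ *
          (((A * (1 + (q - 1) * β * x ^ 2) ^ (-(1 / (q - 1)))) ^ (q - 1) : ℝ) : ℂ)) =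
      A * (((1 + (q - 1) * β * (-(ξ * A ^ (q - 1) / (2 * β))) ^ 2 : ℝ) : ℂ) +
        ((q - 1) * β : ℝ) * (x + (-(ξ * A ^ (q - 1) / (2 * β)) : ℝ) * I) ^ 2) ^
          ((-(1 / (q - 1)) : ℝ) : ℂ) := by
  have hp : 0 < q - 1 := sub_pos.2 hq
  have hS : 0 < 1 + (q - 1) * β * x ^ 2 := by positivity
  have hpow : (A * (1 + (q - 1) * β * x ^ 2) ^ (-(1 / (q - 1)))) ^ (q - 1)
      = A ^ (q - 1) / (1 + (q - 1) * β * x ^ 2) := by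
    rw [Real.mul_rpow hA.le (by positivity), ← Real.rpow_mul hS.le, neg_mul,
      one_div_mul_cancel hp.ne', Real.rpow_neg_one, div_eq_mul_inv]
  rw [hpow]
  generalize A ^ (q - 1) = K
  set S := 1 + (q - 1) * β * x ^ 2 with hSdef
  have harg : I * x * ξ * ((K / S : ℝ) : ℂ) = I * ((x * ξ * (K / S) : ℝ) : ℂ) := by
    push_cast
    ring
  have hne : 1 - ((q : ℂ) - 1) * ((x * ξ * (K / S) : ℝ) : ℂ) * I ≠ 0 := by
    intro h
    simpa using congrArg Complex.re h
  rw [harg, qExp_I_mul hq.ne', ofReal_mul, mul_assoc, ofReal_cpow hS.le,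
    ← ofReal_mul_cpow_of_pos hS hne]
  congr 2
  have hSc : (S : ℂ) ≠ 0 := ofReal_ne_zero.2 hS.ne'
  have hβc : (β : ℂ) ≠ 0 := ofReal_ne_zero.2 hβ.ne'
  have hlhs : (S : ℂ) * (1 - ((q : ℂ) - 1) * ((x * ξ * (K / S) : ℝ) : ℂ) * I)
      = S - (q - 1) * x * ξ * K * I := by
    push_cast
    field_simp
  rw [hlhs, hSdef]
  push_cast
  field_simp
  ring_nf
  simp only [I_sq]
  ring

theorem qFourier_qGaussian_of_one_lt {q : ℝ} (hq1 : 1 < q) (hq3 : q < 3) {β : ℝ} (hβ : 0 < β)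
    (ξ : ℝ) :
    qFourier q (qGaussian q β) ξ =
      (((1 + (q - 1) * β * (-(ξ * (√β / Cq q) ^ (q - 1) / (2 * β))) ^ 2) ^
        (1 / 2 - 1 / (q - 1)) : ℝ) : ℂ) := by
  have hp : 0 < q - 1 := sub_pos.2 hq1
  have hC := Cq_pos hq1 hq3
  have hβ' := Real.sqrt_pos.2 hβ
  have hA : 0 < √β / Cq q := div_pos hβ' hC
  have hG : ∀ x, qGaussian q β x
      = √β / Cq q * (1 + (q - 1) * β * x ^ 2) ^ (-(1 / (q - 1))) := fun x => by
    rw [qGaussian, qExpR_neg_mul_sq hq1 hβ]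
  have huniv : {x : ℝ | 0 < qGaussian q β x} = univ := by
    refine eq_univ_of_forall fun x => ?_
    rw [mem_ofPred_eq, hG]
    positivity
  rw [qFourier, huniv, Measure.restrict_univ]
  simp_rw [hG, mul_qExp_I_mul_eq hq1 hA hβ]
  rw [integral_const_mul, integral_add_mul_sq_cpow_neg (half_lt_one_div_sub_one hq1 hq3)
    (mul_pos hp hβ), integral_add_mul_sq_rpow_neg hβ (by positivity) hp, ← Cq_eq_integral hq1,
    ← ofReal_mul]
  congr 1
  field_simp

theorem qFourier_qGaussian_one {β : ℝ} (hβ : 0 < β) (ξ : ℝ) :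
    qFourier 1 (qGaussian 1 β) ξ = ((Real.exp (-ξ ^ 2 / (4 * β)) : ℝ) : ℂ) := by
  have hC : Cq 1 = √π := by
    simpa [Cq, qExpR] using integral_gaussian 1
  have hβ' := Real.sqrt_pos.2 hβ
  have hπ := Real.sqrt_pos.2 Real.pi_pos
  have hG : ∀ x, qGaussian 1 β x = √β / √π * Real.exp (-β * x ^ 2) := fun x => by
    rw [qGaussian, hC, qExpR, if_pos rfl]
  have huniv : {x : ℝ | 0 < qGaussian 1 β x} = univ := by
    refine eq_univ_of_forall fun x => ?_
    rw [mem_ofPred_eq, hG]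
    positivity
  have hint : ∀ x : ℝ, ((qGaussian 1 β x : ℝ) : ℂ) *
      qExp 1 (I * x * ξ * ((qGaussian 1 β x ^ ((1 : ℝ) - 1) : ℝ) : ℂ)) =
      ((√β / √π : ℝ) : ℂ) * (cexp (I * ξ * x) * cexp (-β * x ^ 2)) := fun x => by
    rw [sub_self, Real.rpow_zero, qExp, if_pos rfl, hG, mul_comm (cexp _), ← mul_assoc]
    push_cast
    congr 2
    ring
  have hsqrt : ((π : ℂ) / β) ^ (1 / 2 : ℂ) = ((√π / √β : ℝ) : ℂ) := by
    rw [← Real.sqrt_div Real.pi_pos.le, Real.sqrt_eq_rpow, ofReal_cpow (by positivity)]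
    push_cast
    rfl
  rw [qFourier, huniv, Measure.restrict_univ]
  simp_rw [hint]
  rw [integral_const_mul, fourierIntegral_gaussian (by simpa using hβ), hsqrt, ← mul_assoc,
    ← ofReal_mul, div_mul_div_cancel₀ hπ.ne', div_self hβ'.ne']
  push_cast
  ring_nf

/-- for `1 ≤ q < 3`, `F_q[G_q(β;·)](ξ) = e_{q'}^{-β₊ ξ²}` with
`q' = (1+q)/(3-q)` and `β₊ = (3-q)/(8 β^{2-q} C_q^{2(q-1)})`. -/
theorem qFourier_qGaussian_of_one_le (q : ℝ) (hq1 : 1 ≤ q) (hq3 : q < 3)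
    (β : ℝ) (hβ : 0 < β) (ξ : ℝ) :
    qFourier q (qGaussian q β) ξ =
      ((qExpR ((1 + q) / (3 - q))
        (-((3 - q) / (8 * β ^ (2 - q) * Cq q ^ (2 * (q - 1)))) * ξ ^ 2) : ℝ) : ℂ) := by
  rcases hq1.eq_or_lt with rfl | hq1
  · rw [qFourier_qGaussian_one hβ, qExpR, if_pos (by norm_num)]
    congr 2
    norm_num
    field_simp
    ring
  have hp : 0 < q - 1 := sub_pos.2 hq1
  have h3 : 0 < 3 - q := sub_pos.2 hq3
  have hC := Cq_pos hq1 hq3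
  have hq' : (1 + q) / (3 - q) ≠ 1 := by
    rw [Ne, div_eq_one_iff_eq h3.ne']
    intro h
    linarith
  have hsub : 1 - (1 + q) / (3 - q) = -(2 * (q - 1) / (3 - q)) := by
    field_simp
    ring
  have hA : ((√β / Cq q) ^ (q - 1)) ^ 2 = β / β ^ (2 - q) / Cq q ^ (2 * (q - 1)) := by
    rw [← Real.rpow_natCast, ← Real.rpow_mul (by positivity), Real.div_rpow (by positivity) hC.le,
      Real.sqrt_eq_rpow, ← Real.rpow_mul hβ.le]
    nth_rewrite 2 [← Real.rpow_one β]
    rw [← Real.rpow_sub hβ]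
    congr 2 <;> push_cast <;> ring
  have hbase : 1 + (1 - (1 + q) / (3 - q)) *
      (-((3 - q) / (8 * β ^ (2 - q) * Cq q ^ (2 * (q - 1)))) * ξ ^ 2)
      = 1 + (q - 1) * β * (-(ξ * (√β / Cq q) ^ (q - 1) / (2 * β))) ^ 2 := by
    rw [hsub, neg_sq, div_pow, mul_pow, hA]
    have hb := Real.rpow_pos_of_pos hβ (2 - q)
    have hc := Real.rpow_pos_of_pos hC (2 * (q - 1))
    field_simp
    ring
  have hexp : 1 / (1 - (1 + q) / (3 - q)) = 1 / 2 - 1 / (q - 1) := by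
    rw [hsub]
    field_simp
    ring
  rw [qFourier_qGaussian_of_one_lt hq1 hq3 hβ, qExpR, if_neg hq', hbase,
    if_neg (not_le.2 (by positivity)), hexp]

end
end

section
/- Let q < 3 and let n ∈ ℤ be such that both n ∈ ℕ_q and n−2 ∈ ℕ_q, and assume q_n > 0. Then 2·C_{q_{n-2}} = √(q_n)·(3 − q_n)·C_{q_n}. (For q = 1 this is the identity 2√π = 2√π.) -/
open MeasureTheory Complex Real Set Filter

noncomputable section

/-- The sequence `q_n = (2q - n(q-1))/(2 - n(q-1))`; `q_n = 1` for all `n` when `q = 1`. -/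
def qseq (q : ℝ) (n : ℤ) : ℝ :=
  if q = 1 then 1 else (2 * q - n * (q - 1)) / (2 - n * (q - 1))

/-- The index set `ℕ_q`. -/
def Nq (q : ℝ) : Set ℤ :=
  if 1 < q then {n : ℤ | (n : ℝ) < 2 / (q - 1) - 1}
  else if q < 1 then {n : ℤ | -2 / (1 - q) < (n : ℝ)}
  else Set.univ

/-- The integral over `[-1, 1]` of `(1 - u²)^b`. -/
def semicircleIntegral (b : ℝ) : ℝ := ∫ u in (-1 : ℝ)..1, (1 - u ^ 2) ^ b

/-- The integral over `ℝ` of `(1 + u²)^(-a)`. -/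
def cauchyIntegral (a : ℝ) : ℝ := ∫ u : ℝ, (1 + u ^ 2) ^ (-a)

lemma semicircleIntegral_recurrence {b : ℝ} (hb : 1 < b) :
    2 * b * semicircleIntegral (b - 1) = (2 * b + 1) * semicircleIntegral b := by
  have hderiv : ∀ x ∈ uIcc (-1 : ℝ) 1, HasDerivAt (fun u : ℝ => u * (1 - u ^ 2) ^ b)
      ((2 * b + 1) * (1 - x ^ 2) ^ b - 2 * b * (1 - x ^ 2) ^ (b - 1)) x := by
    intro x hx
    rw [uIcc_of_le (by norm_num)] at hx
    have hnonneg : 0 ≤ 1 - x ^ 2 := by nlinarith [hx.1, hx.2]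
    have hbase : HasDerivAt (fun u : ℝ => 1 - u ^ 2) (-(2 * x)) x := by
      simpa using (hasDerivAt_pow 2 x).const_sub 1
    have hprod := (hasDerivAt_id x).mul (hbase.rpow_const (p := b) (Or.inr hb.le))
    have hsplit : (1 - x ^ 2) ^ b = (1 - x ^ 2) ^ (b - 1) * (1 - x ^ 2) := by
      rw [← Real.rpow_add_one' hnonneg (by linarith), sub_add_cancel]
    refine hprod.congr_deriv ?_
    simp only [id]
    rw [hsplit]
    ring
  have hcont : ∀ s : ℝ, 0 ≤ s → IntervalIntegrable (fun u : ℝ => (1 - u ^ 2) ^ s) volume (-1) 1 :=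
    fun s hs => (Continuous.rpow_const (by fun_prop) fun _ => Or.inr hs).intervalIntegrable _ _
  have h₁ := (hcont b (by linarith)).const_mul (2 * b + 1)
  have h₂ := (hcont (b - 1) (by linarith)).const_mul (2 * b)
  have hFTC := intervalIntegral.integral_eq_sub_of_hasDerivAt hderiv (h₁.sub h₂)
  rw [intervalIntegral.integral_sub h₁ h₂, intervalIntegral.integral_const_mul,
    intervalIntegral.integral_const_mul] at hFTC
  have hzero : (0 : ℝ) ^ b = 0 := Real.zero_rpow (by linarith)
  norm_num [hzero] at hFTC
  unfold semicircleIntegral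
  linarith

lemma tendsto_mul_one_add_sq_rpow_neg {a : ℝ} (ha : 1 / 2 < a) {l : Filter ℝ}
    (hl : Tendsto (fun x : ℝ => |x|) l atTop) :
    Tendsto (fun u : ℝ => u * (1 + u ^ 2) ^ (-a)) l (nhds 0) := by
  have hpow : Tendsto (fun x : ℝ => |x| ^ (-(2 * a - 1))) l (nhds 0) :=
    (tendsto_rpow_neg_atTop (by linarith)).comp hl
  refine squeeze_zero_norm' ?_ hpow
  filter_upwards [hl.eventually_gt_atTop 0] with x hx
  rw [norm_mul, Real.norm_eq_abs, Real.norm_of_nonneg (by positivity)]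
  calc |x| * (1 + x ^ 2) ^ (-a) ≤ |x| * (|x| ^ 2) ^ (-a) := by
        gcongr ?_ * ?_
        refine Real.rpow_le_rpow_of_nonpos (by positivity) ?_ (by linarith)
        rw [sq_abs]
        linarith
    _ = |x| ^ (-(2 * a - 1)) := by
        rw [← Real.rpow_natCast, ← Real.rpow_mul hx.le, mul_comm, ← Real.rpow_add_one hx.ne']
        congr 1
        push_cast
        ring

lemma cauchyIntegral_recurrence {a : ℝ} (ha : 1 / 2 < a) :
    2 * a * cauchyIntegral (a + 1) = (2 * a - 1) * cauchyIntegral a := by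
  have hderiv : ∀ x : ℝ, HasDerivAt (fun u : ℝ => u * (1 + u ^ 2) ^ (-a))
      (2 * a * (1 + x ^ 2) ^ (-(a + 1)) - (2 * a - 1) * (1 + x ^ 2) ^ (-a)) x := by
    intro x
    have hne : 1 + x ^ 2 ≠ 0 := by positivity
    have hbase : HasDerivAt (fun u : ℝ => 1 + u ^ 2) (2 * x) x := by
      simpa using (hasDerivAt_pow 2 x).const_add 1
    have hprod := (hasDerivAt_id x).mul (hbase.rpow_const (p := -a) (Or.inl hne))
    have hsplit : (1 + x ^ 2) ^ (-a) = (1 + x ^ 2) ^ (-(a + 1)) * (1 + x ^ 2) := by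
      rw [← Real.rpow_add_one hne]
      congr 1
      ring
    refine hprod.congr_deriv ?_
    simp only [id]
    rw [hsplit, show -a - 1 = -(a + 1) by ring]
    ring
  have hint : ∀ s : ℝ, 1 / 2 < s → Integrable (fun u : ℝ => (1 + u ^ 2) ^ (-s)) := by
    intro s hs
    have h := integrable_rpow_neg_one_add_norm_sq (E := ℝ) (μ := volume) (r := 2 * s)
      (by simp; linarith)
    refine h.congr (.of_forall fun u => ?_)
    simp only [Real.norm_eq_abs, sq_abs]
    congr 1
    ring
  have h₁ := (hint (a + 1) (by linarith)).const_mul (2 * a)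
  have h₂ := (hint a ha).const_mul (2 * a - 1)
  have hFTC := integral_of_hasDerivAt_of_tendsto hderiv (h₁.sub h₂)
    (tendsto_mul_one_add_sq_rpow_neg ha tendsto_abs_atBot_atTop)
    (tendsto_mul_one_add_sq_rpow_neg ha tendsto_abs_atTop_atTop)
  rw [integral_sub h₁ h₂, integral_const_mul, integral_const_mul] at hFTC
  unfold cauchyIntegral
  linarith

lemma Cq_one_add_inv {a : ℝ} (ha : 0 < a) : Cq (1 + 1 / a) = √a * cauchyIntegral a := by
  have hinv : 0 < 1 / a := by positivity
  have hscale := Measure.integral_comp_mul_left (fun u : ℝ => (1 + u ^ 2) ^ (-a)) (√a)⁻¹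
  rw [inv_inv, abs_of_nonneg (Real.sqrt_nonneg a), smul_eq_mul] at hscale
  rw [cauchyIntegral, ← hscale, Cq]
  congr 1
  ext x
  have hbase : 1 + (1 - (1 + 1 / a)) * -x ^ 2 = 1 + ((√a)⁻¹ * x) ^ 2 := by
    rw [mul_pow, inv_pow, Real.sq_sqrt ha.le]
    ring
  have hexp : 1 / (1 - (1 + 1 / a)) = -a := by
    rw [sub_add_cancel_left, one_div, inv_neg, one_div, inv_inv]
  rw [qExpR, if_neg (by linarith), hbase, hexp, if_neg (not_le.mpr (by positivity))]

lemma Cq_one_sub_inv {b : ℝ} (hb : 0 < b) : Cq (1 - 1 / b) = √b * semicircleIntegral b := by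
  have hinv : 0 < 1 / b := by positivity
  have hscale := Measure.integral_comp_mul_left
    ((Ioc (-1 : ℝ) 1).indicator fun u : ℝ => (1 - u ^ 2) ^ b) (√b)⁻¹
  rw [inv_inv, abs_of_nonneg (Real.sqrt_nonneg b), smul_eq_mul,
    integral_indicator measurableSet_Ioc] at hscale
  rw [semicircleIntegral, intervalIntegral.integral_of_le (by norm_num), ← hscale, Cq]
  congr 1
  ext x
  have hbase : 1 + (1 - (1 - 1 / b)) * -x ^ 2 = 1 - ((√b)⁻¹ * x) ^ 2 := by
    rw [mul_pow, inv_pow, Real.sq_sqrt hb.le]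
    ring
  have hexp : 1 / (1 - (1 - 1 / b)) = b := by
    rw [sub_sub_cancel, one_div_one_div]
  rw [qExpR, if_neg (by linarith), hbase, hexp]
  generalize (√b)⁻¹ * x = u
  by_cases hu : u ∈ Ioc (-1 : ℝ) 1
  · rw [indicator_of_mem hu]
    split_ifs with hle
    · rw [le_antisymm hle (by nlinarith [hu.1, hu.2]), Real.zero_rpow hb.ne']
    · rfl
  · rw [indicator_of_notMem hu, if_pos]
    by_contra! hlt
    exact hu ⟨by nlinarith, by nlinarith⟩

lemma two_mul_Cq_of_one_lt {a : ℝ} (ha : 1 / 2 < a) :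
    2 * Cq (1 + 1 / (a + 1)) = √(1 + 1 / a) * (3 - (1 + 1 / a)) * Cq (1 + 1 / a) := by
  have ha₀ : 0 < a := by linarith
  rw [Cq_one_add_inv ha₀, Cq_one_add_inv (by linarith : 0 < a + 1)]
  have hsqrt : √(1 + 1 / a) * √a = √(a + 1) := by
    rw [← Real.sqrt_mul (by positivity)]
    congr 1
    field_simp
  have hrec : 2 * cauchyIntegral (a + 1) = (3 - (1 + 1 / a)) * cauchyIntegral a := by
    have h := cauchyIntegral_recurrence ha
    field_simp
    linarith
  linear_combination √(a + 1) * hrec - (3 - (1 + 1 / a)) * cauchyIntegral a * hsqrt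

lemma two_mul_Cq_of_lt_one {b : ℝ} (hb : 1 < b) :
    2 * Cq (1 - 1 / (b - 1)) = √(1 - 1 / b) * (3 - (1 - 1 / b)) * Cq (1 - 1 / b) := by
  have hb₀ : 0 < b := by linarith
  rw [Cq_one_sub_inv hb₀, Cq_one_sub_inv (by linarith : 0 < b - 1)]
  have hsqrt : √(1 - 1 / b) * √b = √(b - 1) := by
    rw [← Real.sqrt_mul' _ hb₀.le]
    congr 1
    field_simp
  have hrec : 2 * semicircleIntegral (b - 1) = (3 - (1 - 1 / b)) * semicircleIntegral b := by
    have h := semicircleIntegral_recurrence hb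
    field_simp
    linarith
  linear_combination √(b - 1) * hrec - (3 - (1 - 1 / b)) * semicircleIntegral b * hsqrt

lemma qseq_eq_one_add_inv {q : ℝ} (hq : q ≠ 1) {n : ℤ} (hn : 1 / (q - 1) - n / 2 ≠ 0) :
    qseq q n = 1 + 1 / (1 / (q - 1) - n / 2) := by
  have hq' : q - 1 ≠ 0 := sub_ne_zero.mpr hq
  have hden : 2 - n * (q - 1) = 2 * (q - 1) * (1 / (q - 1) - n / 2) := by
    field_simp
  have hden₀ : 2 - n * (q - 1) ≠ 0 := by
    rw [hden]
    exact mul_ne_zero (mul_ne_zero two_ne_zero hq') hn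
  rw [qseq, if_neg hq, div_eq_iff hden₀, hden]
  generalize hs : 1 / (q - 1) - (n : ℝ) / 2 = s at hn hden ⊢
  field_simp
  linear_combination hden

/-- `2 C_{q_{n-2}} = √(q_n) (3 - q_n) C_{q_n}`. -/
theorem Cq_qseq_identity (q : ℝ) (hq : q < 3) (n : ℤ)
    (hn : n ∈ Nq q) (hn2 : n - 2 ∈ Nq q) (hpos : 0 < qseq q n) :
    2 * Cq (qseq q (n - 2)) = Real.sqrt (qseq q n) * (3 - qseq q n) * Cq (qseq q n) := by
  rcases lt_trichotomy q 1 with h | rfl | h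
  · simp only [Nq, if_neg h.not_gt, if_pos h, mem_ofPred_eq] at hn hn2
    have hflip : -2 / (1 - q) = 2 * (1 / (q - 1)) := by
      rw [← neg_sub q 1, neg_div_neg_eq]
      ring
    rw [hflip] at hn hn2
    push_cast at hn2
    rw [qseq_eq_one_add_inv h.ne (n := n) (by linarith),
      qseq_eq_one_add_inv h.ne (n := n - 2) (by push_cast; linarith)]
    have key := two_mul_Cq_of_lt_one (b := n / 2 - 1 / (q - 1)) (by linarith)
    have hneg : ∀ t : ℝ, 1 - 1 / t = 1 + 1 / (-t) := fun t => by
      rw [one_div_neg_eq_neg_one_div, sub_eq_add_neg]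
    simp only [hneg (n / 2 - 1 / (q - 1)), hneg (n / 2 - 1 / (q - 1) - 1)] at key
    convert key using 4 <;> push_cast <;> ring
  · norm_num [qseq]
  · simp only [Nq, if_pos h, mem_ofPred_eq] at hn hn2
    have hhalf : 2 / (q - 1) = 2 * (1 / (q - 1)) := by ring
    rw [hhalf] at hn hn2
    push_cast at hn2
    rw [qseq_eq_one_add_inv h.ne' (n := n) (by linarith),
      qseq_eq_one_add_inv h.ne' (n := n - 2) (by push_cast; linarith)]
    have key := two_mul_Cq_of_one_lt (a := 1 / (q - 1) - n / 2) (by linarith)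
    convert key using 4
    push_cast
    ring

end
end

section
/- Let 1 ≤ q < 3. Then the function ξ ↦ Y(q,ξ) is differentiable on ℝ and satisfies the homogeneous functional-differential equation 2√q·∂_ξ Y(q,ξ) + ξ·Y(2 − 1/q, √q·ξ) = 0 for every ξ ∈ ℝ. -/
open MeasureTheory Complex Real Set Filter

noncomputable section

/-- `Y(q,ξ) = ∫_{-K}^{K} e_q^{-x² + i x ξ} dx`, with `K = (1-q)^{-1/2}` if `q < 1`
and the integral over all of `ℝ` if `q ≥ 1`. -/
def Yfun (q ξ : ℝ) : ℂ :=
  if q < 1 then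
    ∫ x in Set.Ioo (-((1 - q) ^ (-(1 : ℝ) / 2))) ((1 - q) ^ (-(1 : ℝ) / 2)),
      qExp q (-(x : ℂ) ^ 2 + Complex.I * (x : ℂ) * (ξ : ℂ))
  else ∫ x : ℝ, qExp q (-(x : ℂ) ^ 2 + Complex.I * (x : ℂ) * (ξ : ℂ))

/-- Differentiation under the integral sign, followed by the identity
`∫ (-2x + iξ) k(-x² + ixξ) dx = 0`. -/
theorem hasDerivAt_integral_comp_neg_sq_add {h k : ℂ → ℂ} {Φ Ψ : ℝ → ℝ}
    (hderiv : ∀ z : ℂ, z.re ≤ 0 → HasDerivAt h (k z) z)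
    (hk : ∀ z : ℂ, z.re ≤ 0 → ContinuousAt k z)
    (hΦ : ∀ z : ℂ, z.re ≤ 0 → ‖h z‖ ≤ Φ z.re) (hΨ : ∀ z : ℂ, z.re ≤ 0 → ‖k z‖ ≤ Ψ z.re)
    (iΦ : Integrable fun x : ℝ => Φ (-x ^ 2)) (iΨ : Integrable fun x : ℝ => Ψ (-x ^ 2))
    (ixΨ : Integrable fun x : ℝ => |x| * Ψ (-x ^ 2)) (ξ : ℝ) :
    HasDerivAt (fun ξ : ℝ => ∫ x : ℝ, h (-(x : ℂ) ^ 2 + I * x * ξ))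
      (-(ξ / 2) * ∫ x : ℝ, k (-(x : ℂ) ^ 2 + I * x * ξ)) ξ := by
  have hre (x ξ : ℝ) : (-(x : ℂ) ^ 2 + I * x * ξ).re = -x ^ 2 := by
    simp [← ofReal_pow]
  have hre0 (x ξ : ℝ) : (-(x : ℂ) ^ 2 + I * x * ξ).re ≤ 0 := by
    rw [hre]; nlinarith [sq_nonneg x]
  have hcont (ξ : ℝ) : Continuous fun x : ℝ => -(x : ℂ) ^ 2 + I * x * ξ := by fun_prop
  have hhc (ξ : ℝ) : Continuous fun x : ℝ => h (-(x : ℂ) ^ 2 + I * x * ξ) :=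
    continuous_iff_continuousAt.2 fun x =>
      ContinuousAt.comp (f := fun x : ℝ => -(x : ℂ) ^ 2 + I * x * ξ)
        (hderiv _ (hre0 x ξ)).continuousAt (hcont ξ).continuousAt
  have hkc (ξ : ℝ) : Continuous fun x : ℝ => k (-(x : ℂ) ^ 2 + I * x * ξ) :=
    continuous_iff_continuousAt.2 fun x =>
      ContinuousAt.comp (f := fun x : ℝ => -(x : ℂ) ^ 2 + I * x * ξ)
        (hk _ (hre0 x ξ)) (hcont ξ).continuousAt
  have hkΨ (x ξ : ℝ) : ‖k (-(x : ℂ) ^ 2 + I * x * ξ)‖ ≤ Ψ (-x ^ 2) :=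
    (hΨ _ (hre0 x ξ)).trans_eq (by rw [hre])
  have ih : Integrable fun x : ℝ => h (-(x : ℂ) ^ 2 + I * x * ξ) :=
    iΦ.mono' (hhc ξ).aestronglyMeasurable
      (.of_forall fun x => (hΦ _ (hre0 x ξ)).trans_eq (by rw [hre]))
  have ik : Integrable fun x : ℝ => k (-(x : ℂ) ^ 2 + I * x * ξ) :=
    iΨ.mono' (hkc ξ).aestronglyMeasurable (.of_forall fun x => hkΨ x ξ)
  have hcxk : Continuous fun x : ℝ => (x : ℂ) * k (-(x : ℂ) ^ 2 + I * x * ξ) :=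
    continuous_ofReal.mul (hkc ξ)
  have ixk : Integrable fun x : ℝ => (x : ℂ) * k (-(x : ℂ) ^ 2 + I * x * ξ) := by
    refine ixΨ.mono' hcxk.aestronglyMeasurable (.of_forall fun x => ?_)
    rw [norm_mul, norm_real, Real.norm_eq_abs]
    gcongr
    exact hkΨ x ξ
  have hzero : ∫ x : ℝ, (-2 * ((x : ℂ) * k (-(x : ℂ) ^ 2 + I * x * ξ))
      + I * ξ * k (-(x : ℂ) ^ 2 + I * x * ξ)) = 0 := by
    refine integral_eq_zero_of_hasDerivAt_of_integrable (fun x => ?_)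
      ((ixk.const_mul _).add (ik.const_mul _)) ih
    have hin : HasDerivAt (fun x : ℂ => -x ^ 2 + I * x * ξ) (-(2 * x) + I * ξ) x := by
      have := ((hasDerivAt_pow 2 (x : ℂ)).neg).add
        (((hasDerivAt_id (x : ℂ)).const_mul I).mul_const (ξ : ℂ))
      convert! this using 1
      simp
    have := ((hderiv _ (hre0 x ξ)).comp (x : ℂ) hin).comp_ofReal
    convert! this using 1
    ring
  rw [integral_add (ixk.const_mul _) (ik.const_mul _), integral_const_mul,
    integral_const_mul] at hzero
  have hmain := (hasDerivAt_integral_of_dominated_loc_of_deriv_le (x₀ := ξ) (s := univ)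
    (F := fun ξ x : ℝ => h (-(x : ℂ) ^ 2 + I * x * ξ))
    (F' := fun ξ x : ℝ => I * ((x : ℂ) * k (-(x : ℂ) ^ 2 + I * x * ξ)))
    univ_mem (.of_forall fun ξ => (hhc ξ).aestronglyMeasurable) ih
    (continuous_const.mul hcxk).aestronglyMeasurable
    (.of_forall fun x ξ _ => by
      rw [norm_mul, norm_mul, norm_I, one_mul, norm_real, Real.norm_eq_abs]
      gcongr
      exact hkΨ x ξ) ixΨ
    (.of_forall fun x ξ _ => by
      have hin : HasDerivAt (fun ξ : ℂ => -(x : ℂ) ^ 2 + I * x * ξ) (I * x) ξ := by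
        simpa using ((hasDerivAt_id (ξ : ℂ)).const_mul (I * (x : ℂ))).const_add (-(x : ℂ) ^ 2)
      have := ((hderiv _ (hre0 x ξ)).comp (ξ : ℂ) hin).comp_ofReal
      convert! this using 1
      ring)).2
  convert! hmain using 1
  rw [integral_const_mul]
  linear_combination (I / 2) * hzero -
    ((ξ : ℂ) / 2 * ∫ x : ℝ, k (-(x : ℂ) ^ 2 + I * x * ξ)) * I_sq

theorem qExp_of_one_lt {q : ℝ} (hq : 1 < q) {z : ℂ} (hz : -1 < (q - 1) * -z.re) :
    qExp q z = (1 + (1 - q) * z) ^ ((1 : ℂ) / (1 - q)) := by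
  have hre : (1 + (1 - (q : ℂ)) * z).re = 1 + (1 - q) * z.re := by simp
  rw [qExp, if_neg hq.ne', if_neg]
  rintro ⟨-, h⟩
  rw [hre] at h
  linarith

theorem qExpR_of_one_lt {q : ℝ} (hq : 1 < q) {t : ℝ} (ht : t ≤ 0) :
    qExpR q t = (1 + (1 - q) * t) ^ ((1 : ℝ) / (1 - q)) := by
  rw [qExpR, if_neg hq.ne', if_neg]
  nlinarith

theorem one_lt_two_sub_one_div {q : ℝ} (hq : 1 < q) : 1 < 2 - 1 / q := by
  have : 1 / q < 1 := by rw [div_lt_one (by linarith)]; exact hq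
  linarith

/-- On the left half-plane, the `q`-exponential has derivative
`z ↦ e_{2 - 1/q}^{q z}`. -/
theorem hasDerivAt_qExp {q : ℝ} (hq : 1 ≤ q) {z : ℂ} (hz : z.re ≤ 0) :
    HasDerivAt (qExp q) (qExp (2 - 1 / q) (q * z)) z := by
  rcases hq.eq_or_lt with rfl | hq
  · have : qExp 1 = Complex.exp := by ext; simp [qExp]
    norm_num [this, Complex.hasDerivAt_exp]
  have hq0 : (q : ℂ) ≠ 0 := ofReal_ne_zero.2 (by linarith)
  have hq1 : (1 : ℂ) - q ≠ 0 := by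
    rw [← ofReal_one, ← ofReal_sub]; exact ofReal_ne_zero.2 (by linarith)
  have hpos {w : ℂ} (hw : w.re ≤ 0) {r : ℝ} (hr : 1 < r) : -1 < (r - 1) * -w.re := by nlinarith
  have hev : qExp q =ᶠ[nhds z] fun z => (1 + (1 - q) * z) ^ ((1 : ℂ) / (1 - q)) := by
    have : ∀ᶠ w : ℂ in nhds z, -1 < (q - 1) * -w.re :=
      (by fun_prop : Continuous fun w : ℂ => (q - 1) * -w.re).continuousAt.eventually
        (lt_mem_nhds (hpos hz hq))
    filter_upwards [this] with w hw using qExp_of_one_lt hq hw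
  refine HasDerivAt.congr_of_eventuallyEq ?_ hev
  have hslit : 1 + (1 - q) * z ∈ slitPlane := by
    left
    simp
    nlinarith
  have hin : HasDerivAt (fun z : ℂ => 1 + (1 - q) * z) (1 - q) z := by
    simpa using ((hasDerivAt_id z).const_mul (1 - (q : ℂ))).const_add 1
  convert! hin.cpow_const (c := (1 : ℂ) / (1 - q)) hslit using 1
  have hqz : (q * z).re ≤ 0 := by
    rw [re_ofReal_mul]; nlinarith
  rw [qExp_of_one_lt (one_lt_two_sub_one_div hq) (hpos hqz (one_lt_two_sub_one_div hq))]
  have hbase : 1 + (1 - ((2 - 1 / q : ℝ) : ℂ)) * (q * z) = 1 + (1 - q) * z := by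
    push_cast; field_simp; ring
  have hexp : (1 : ℂ) / (1 - ((2 - 1 / q : ℝ) : ℂ)) = 1 / (1 - q) - 1 := by
    have : (1 : ℂ) - ((2 - 1 / q : ℝ) : ℂ) = (1 - q) / q := by
      push_cast; field_simp; ring
    rw [this]; field_simp; ring
  rw [hbase, hexp]
  field_simp

theorem norm_qExp_le {q : ℝ} (hq : 1 ≤ q) {z : ℂ} (hz : z.re ≤ 0) :
    ‖qExp q z‖ ≤ qExpR q z.re := by
  rcases hq.eq_or_lt with rfl | hq
  · simp [qExp, qExpR, Complex.norm_exp]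
  rw [qExp_of_one_lt hq (by nlinarith), qExpR_of_one_lt hq hz]
  have hexp : (1 : ℂ) / (1 - q) = ((1 / (1 - q) : ℝ) : ℂ) := by push_cast; rfl
  rw [hexp, norm_cpow_real]
  have hre : (1 + (1 - (q : ℂ)) * z).re = 1 + (1 - q) * z.re := by simp
  refine Real.rpow_le_rpow_of_nonpos (by nlinarith) (hre ▸ re_le_norm _) ?_
  exact div_nonpos_of_nonneg_of_nonpos zero_le_one (by linarith)

theorem integrable_qExpR_neg_sq {q : ℝ} (hq : 1 ≤ q) (hq3 : q < 3) :
    Integrable fun x : ℝ => qExpR q (-x ^ 2) := by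
  rcases hq.eq_or_lt with rfl | hq
  · simpa [qExpR] using integrable_exp_neg_mul_sq one_pos
  have hr : (Module.finrank ℝ ℝ : ℝ) < 2 / (q - 1) := by
    rw [Module.finrank_self, Nat.cast_one, lt_div_iff₀ (by linarith)]
    linarith
  have := (integrable_rpow_neg_one_add_norm_sq (μ := volume) hr).comp_mul_left'
    (Real.sqrt_pos.2 (sub_pos.2 hq)).ne'
  refine this.congr (.of_forall fun x => ?_)
  dsimp only
  rw [qExpR_of_one_lt hq (by nlinarith [sq_nonneg x]), Real.norm_eq_abs, sq_abs, mul_pow,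
    Real.sq_sqrt (by linarith)]
  have h1 : q - 1 ≠ 0 := by linarith
  have h2 : 1 - q ≠ 0 := by linarith
  congr 1
  · ring
  · field_simp; ring

theorem integrable_qExpR_mul_neg_sq {q : ℝ} (hq : 1 ≤ q) :
    Integrable fun x : ℝ => qExpR (2 - 1 / q) (q * -x ^ 2) := by
  have hq0 : 0 < q := by linarith
  have h1 : 1 / q ≤ 1 := by rwa [div_le_one hq0]
  have h0 : 0 < 1 / q := by positivity
  have := (integrable_qExpR_neg_sq (q := 2 - 1 / q) (by linarith) (by linarith)).comp_mul_left'
    (Real.sqrt_pos.2 hq0).ne'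
  refine this.congr (.of_forall fun x => ?_)
  dsimp only
  rw [mul_pow, Real.sq_sqrt hq0.le, mul_neg]

theorem integrable_abs_mul_qExpR_mul_neg_sq {q : ℝ} (hq : 1 ≤ q) (hq3 : q < 3) :
    Integrable fun x : ℝ => |x| * qExpR (2 - 1 / q) (q * -x ^ 2) := by
  rcases hq.eq_or_lt with rfl | hq
  · refine (integrable_mul_exp_neg_mul_sq one_pos).abs.congr (.of_forall fun x => ?_)
    norm_num [qExpR, abs_mul]
  refine ((integrable_qExpR_neg_sq hq.le hq3).const_mul (1 + 1 / (q - 1))).mono'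
    (continuous_abs.aestronglyMeasurable.mul
      (integrable_qExpR_mul_neg_sq hq.le).aestronglyMeasurable) (.of_forall fun x => ?_)
  have hx : -x ^ 2 ≤ 0 := by nlinarith [sq_nonneg x]
  have hq1 : 0 < q - 1 := by linarith
  have hq1' : 1 - q ≠ 0 := by linarith
  have hq0 : q ≠ 0 := by linarith
  have hB : 0 < 1 + (1 - q) * -x ^ 2 := by nlinarith
  rw [qExpR_of_one_lt hq hx, qExpR_of_one_lt (one_lt_two_sub_one_div hq) (by nlinarith)]
  have hbase : 1 + (1 - (2 - 1 / q)) * (q * -x ^ 2) = 1 + (1 - q) * -x ^ 2 := by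
    field_simp; ring
  have hexp : 1 / (1 - (2 - 1 / q)) = 1 / (1 - q) - 1 := by
    have : 1 - (2 - 1 / q) = (1 - q) / q := by field_simp; ring
    rw [this]; field_simp; ring
  rw [hbase, hexp, Real.rpow_sub_one hB.ne', Real.norm_eq_abs, abs_of_nonneg (by positivity),
    mul_div_left_comm, mul_comm]
  gcongr
  rw [div_le_iff₀ hB]
  have hexpand : (1 + 1 / (q - 1)) * (1 + (1 - q) * -x ^ 2)
      = 1 + 1 / (q - 1) + (q - 1) * x ^ 2 + x ^ 2 := by
    field_simp; ring
  have : 0 < 1 / (q - 1) := by positivity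
  rw [hexpand]
  nlinarith [sq_nonneg (|x| - 1), sq_abs x, mul_nonneg hq1.le (sq_nonneg x), abs_nonneg x]

theorem Yfun_of_one_le {q : ℝ} (hq : 1 ≤ q) (ξ : ℝ) :
    Yfun q ξ = ∫ x : ℝ, qExp q (-(x : ℂ) ^ 2 + I * x * ξ) :=
  if_neg hq.not_gt

/-- `∫ e_{2 - 1/q}^{q(-x² + ixξ)} dx` is a rescaling of `Y(2 - 1/q, √q ξ)`. -/
theorem Yfun_two_sub_one_div {q : ℝ} (hq : 1 ≤ q) (ξ : ℝ) :
    Yfun (2 - 1 / q) (√q * ξ) =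
      √q * ∫ x : ℝ, qExp (2 - 1 / q) (q * (-(x : ℂ) ^ 2 + I * x * ξ)) := by
  have hq0 : 0 < q := by linarith
  have h1 : 1 / q ≤ 1 := by rwa [div_le_one hq0]
  have hs : 0 < √q := Real.sqrt_pos.2 hq0
  have hs2 : (√q : ℂ) ^ 2 = q := by rw [← ofReal_pow, Real.sq_sqrt hq0.le]
  have hsub := Measure.integral_comp_mul_left
    (fun x : ℝ => qExp (2 - 1 / q) (-(x : ℂ) ^ 2 + I * x * (√q * ξ : ℝ))) √q
  have hrw (x : ℝ) : -((√q * x : ℝ) : ℂ) ^ 2 + I * (√q * x : ℝ) * (√q * ξ : ℝ)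
      = q * (-(x : ℂ) ^ 2 + I * x * ξ) := by
    push_cast; rw [← hs2]; ring
  simp only [hrw] at hsub
  rw [Yfun_of_one_le (by linarith), hsub, abs_of_pos (inv_pos.2 hs), real_smul, ← mul_assoc,
    ← ofReal_mul, mul_inv_cancel₀ hs.ne', ofReal_one, one_mul]

theorem hasDerivAt_Yfun {q : ℝ} (hq1 : 1 ≤ q) (hq3 : q < 3) (ξ : ℝ) :
    HasDerivAt (Yfun q)
      (-(ξ / 2) * ∫ x : ℝ, qExp (2 - 1 / q) (q * (-(x : ℂ) ^ 2 + I * x * ξ))) ξ := by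
  have hq' : 1 ≤ 2 - 1 / q := by
    have : 1 / q ≤ 1 := by rwa [div_le_one (by linarith)]
    linarith
  have hqz {z : ℂ} (hz : z.re ≤ 0) : (q * z).re ≤ 0 := by
    rw [re_ofReal_mul]; nlinarith
  rw [funext (Yfun_of_one_le hq1)]
  exact hasDerivAt_integral_comp_neg_sq_add (k := fun z => qExp (2 - 1 / q) (q * z))
    (Φ := qExpR q) (Ψ := fun t => qExpR (2 - 1 / q) (q * t))
    (fun z hz => hasDerivAt_qExp hq1 hz)
    (fun z hz => ContinuousAt.comp (f := fun z : ℂ => q * z)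
      (hasDerivAt_qExp hq' (hqz hz)).continuousAt (by fun_prop))
    (fun z hz => norm_qExp_le hq1 hz)
    (fun z hz => (norm_qExp_le hq' (hqz hz)).trans_eq (by rw [re_ofReal_mul]))
    (integrable_qExpR_neg_sq hq1 hq3) (integrable_qExpR_mul_neg_sq hq1)
    (integrable_abs_mul_qExpR_mul_neg_sq hq1 hq3) ξ

/-- for `1 ≤ q < 3`, `Y(q,·)` is differentiable and satisfies
`2√q ∂_ξ Y(q,ξ) + ξ Y(2 - 1/q, √q ξ) = 0`. -/
theorem Yfun_fde_of_one_le (q : ℝ) (hq1 : 1 ≤ q) (hq3 : q < 3) :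
    Differentiable ℝ (Yfun q) ∧
    ∀ ξ : ℝ, ((2 * Real.sqrt q : ℝ) : ℂ) * deriv (Yfun q) ξ +
      (ξ : ℂ) * Yfun (2 - 1 / q) (Real.sqrt q * ξ) = 0 := by
  refine ⟨fun ξ => (hasDerivAt_Yfun hq1 hq3 ξ).differentiableAt, fun ξ => ?_⟩
  rw [(hasDerivAt_Yfun hq1 hq3 ξ).deriv, Yfun_two_sub_one_div hq1]
  push_cast
  ring

end
end

section
/- Let 0 < q < 1 with q ≠ l/(l+1) for every positive integer l. Then ξ ↦ Y(q,ξ) is differentiable and satisfies, for every ξ > 0, the inhomogeneous functional-differential equation 2√q·∂_ξ Y(q,ξ) + ξ·Y(2 − 1/q, √q·ξ) = r_q·ξ^{1/(1-q)}, where r_q := 2√q · sin( π/(2(1-q)) ) · (1-q)^{1/(2(1-q))}. -/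
open MeasureTheory Complex Real Set Filter

noncomputable section

/-- The base `1 - a x² + i a ξ x` of the power in the integrand of `Yfun (1 - a) ξ`. -/
def qBase (a ξ x : ℝ) : ℂ := 1 - a * x ^ 2 + a * ξ * x * Complex.I

lemma qBase_re (a ξ x : ℝ) : (qBase a ξ x).re = 1 - a * x ^ 2 := by
  simp [qBase, ← Complex.ofReal_pow]

lemma qBase_im (a ξ x : ℝ) : (qBase a ξ x).im = a * ξ * x := by
  simp [qBase, ← Complex.ofReal_pow]

lemma continuous_qBase (a ξ : ℝ) : Continuous (qBase a ξ) := by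
  unfold qBase
  fun_prop

lemma mul_sq_lt_one {a x : ℝ} (ha : 0 < a) (hx : x ∈ Ioo (-(√a)⁻¹) (√a)⁻¹) :
    a * x ^ 2 < 1 := by
  have hs : 0 < √a := Real.sqrt_pos.2 ha
  have hx2 : x ^ 2 < (√a)⁻¹ ^ 2 := sq_lt_sq' hx.1 hx.2
  rw [inv_pow, Real.sq_sqrt ha.le] at hx2
  calc a * x ^ 2 < a * a⁻¹ := mul_lt_mul_of_pos_left hx2 ha
    _ = 1 := mul_inv_cancel₀ ha.ne'

lemma qBase_re_pos {a x : ℝ} (ξ : ℝ) (ha : 0 < a) (hx : x ∈ Ioo (-(√a)⁻¹) (√a)⁻¹) :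
    0 < (qBase a ξ x).re := by
  rw [qBase_re]
  linarith [mul_sq_lt_one ha hx]

lemma qBase_mem_slitPlane {a ξ : ℝ} (x : ℝ) (ha : 0 < a) (hξ : 0 < ξ) :
    qBase a ξ x ∈ Complex.slitPlane := by
  rw [Complex.mem_slitPlane_iff, qBase_re, qBase_im]
  rcases eq_or_ne x 0 with rfl | hx
  · left; norm_num
  · right; positivity

lemma Yfun_eq_intervalIntegral {q : ℝ} (hq : q < 1) (ξ : ℝ) :
    Yfun q ξ = ∫ x in (-(√(1 - q))⁻¹)..(√(1 - q))⁻¹,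
      qBase (1 - q) ξ x ^ (((1 - q)⁻¹ : ℝ) : ℂ) := by
  have ha : 0 < 1 - q := sub_pos.2 hq
  have hK : (1 - q) ^ (-(1 : ℝ) / 2) = (√(1 - q))⁻¹ := by
    rw [neg_div, Real.rpow_neg ha.le, Real.sqrt_eq_rpow]
  have hle : -(√(1 - q))⁻¹ ≤ (√(1 - q))⁻¹ := by
    have : 0 ≤ (√(1 - q))⁻¹ := by positivity
    linarith
  rw [Yfun, if_pos hq, hK, intervalIntegral.integral_of_le hle, integral_Ioc_eq_integral_Ioo]
  refine setIntegral_congr_fun measurableSet_Ioo fun x hx => ?_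
  have hbase : 1 + (1 - (q : ℂ)) * (-(x : ℂ) ^ 2 + Complex.I * x * ξ) = qBase (1 - q) ξ x := by
    simp only [qBase]
    push_cast
    ring
  simp only [qExp, if_neg hq.ne, hbase]
  rw [if_neg fun h => not_lt.2 h.2 (qBase_re_pos ξ ha hx)]
  push_cast
  rw [one_div]

lemma hasDerivAt_qBase_cpow_param {a ξ x r : ℝ} (h : qBase a ξ x ∈ Complex.slitPlane) :
    HasDerivAt (fun ξ => qBase a ξ x ^ (r : ℂ))
      (r * qBase a ξ x ^ (((r - 1 : ℝ)) : ℂ) * (a * x * Complex.I)) ξ := by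
  have hb : HasDerivAt (fun ξ : ℝ => qBase a ξ x) (a * x * Complex.I) ξ := by
    have := ((((hasDerivAt_id ξ).ofReal_comp.const_mul (a : ℂ)).mul_const
      (x : ℂ)).mul_const Complex.I).const_add (1 - (a : ℂ) * (x : ℂ) ^ 2)
    simpa [qBase] using this
  have hc := (hasStrictDerivAt_cpow_const (c := (r : ℂ)) h).hasDerivAt.comp ξ hb
  simpa [Function.comp_def] using hc

lemma hasDerivAt_qBase_cpow {a ξ x r : ℝ} (h : qBase a ξ x ∈ Complex.slitPlane) :
    HasDerivAt (fun x => qBase a ξ x ^ (r : ℂ))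
      (r * qBase a ξ x ^ (((r - 1 : ℝ)) : ℂ) * (a * Complex.I * (ξ + 2 * Complex.I * x))) x := by
  have hb : HasDerivAt (fun x : ℝ => qBase a ξ x) (a * Complex.I * (ξ + 2 * Complex.I * x)) x := by
    have hx := (hasDerivAt_id x).ofReal_comp
    have := (((hx.pow 2).const_mul (a : ℂ)).const_sub 1).add
      ((hx.const_mul ((a : ℂ) * ξ)).mul_const Complex.I)
    refine this.congr_deriv ?_
    simp only [id, Complex.ofReal_one]
    norm_num
    linear_combination -2 * (a : ℂ) * x * Complex.I_sq
  have hc := (hasStrictDerivAt_cpow_const (c := (r : ℂ)) h).hasDerivAt.comp x hb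
  simpa [Function.comp_def] using hc

lemma norm_qBase_le {a ξ x : ℝ} (ha : 0 < a) (hx : x ∈ Ioo (-(√a)⁻¹) (√a)⁻¹) :
    ‖qBase a ξ x‖ ≤ 1 + a * |ξ| * (√a)⁻¹ := by
  refine (Complex.norm_le_abs_re_add_abs_im _).trans ?_
  have h1 := qBase_re_pos ξ ha hx
  rw [abs_of_pos h1, qBase_re, qBase_im, abs_mul, abs_mul, abs_of_pos ha]
  have hx' : |x| ≤ (√a)⁻¹ := (abs_lt.2 hx).le
  have : a * |ξ| * |x| ≤ a * |ξ| * (√a)⁻¹ := by gcongr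
  nlinarith [mul_nonneg ha.le (sq_nonneg x)]

lemma aestronglyMeasurable_qBase_cpow (a ξ r : ℝ) (μ : Measure ℝ) :
    AEStronglyMeasurable (fun x => qBase a ξ x ^ (r : ℂ)) μ :=
  ((continuous_qBase a ξ).measurable.pow_const _).aestronglyMeasurable

lemma norm_qBase_cpow_le {a ξ x r R : ℝ} (ha : 0 < a) (hr : 0 ≤ r) (hξ : |ξ| ≤ R)
    (hx : x ∈ Ioo (-(√a)⁻¹) (√a)⁻¹) :
    ‖qBase a ξ x ^ (r : ℂ)‖ ≤ (1 + a * R * (√a)⁻¹) ^ r := by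
  rw [Complex.norm_cpow_real]
  refine Real.rpow_le_rpow (norm_nonneg _) ((norm_qBase_le ha hx).trans ?_) hr
  gcongr

/-- Differentiation under the integral sign. -/
lemma hasDerivAt_integral_qBase_cpow {a r : ℝ} (ha : 0 < a) (hr : 1 ≤ r) (ξ : ℝ) :
    HasDerivAt (fun ξ => ∫ x in (-(√a)⁻¹)..(√a)⁻¹, qBase a ξ x ^ (r : ℂ))
      (∫ x in (-(√a)⁻¹)..(√a)⁻¹,
        r * qBase a ξ x ^ (((r - 1 : ℝ)) : ℂ) * (a * x * Complex.I)) ξ := by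
  have hle : -(√a)⁻¹ ≤ (√a)⁻¹ := by
    have : 0 ≤ (√a)⁻¹ := by positivity
    linarith
  simp only [intervalIntegral.integral_of_le hle, integral_Ioc_eq_integral_Ioo]
  refine (hasDerivAt_integral_of_dominated_loc_of_deriv_le
    (F' := fun ξ x => r * qBase a ξ x ^ (((r - 1 : ℝ)) : ℂ) * (a * x * Complex.I))
    (bound := fun _ => r * (1 + a * (|ξ| + 1) * (√a)⁻¹) ^ (r - 1) * (a * (√a)⁻¹))
    (Metric.ball_mem_nhds ξ one_pos)
    (Eventually.of_forall fun η => aestronglyMeasurable_qBase_cpow a η r _) ?_ ?_ ?_ ?_ ?_).2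
  · refine Integrable.of_bound (aestronglyMeasurable_qBase_cpow a ξ r _)
      ((1 + a * |ξ| * (√a)⁻¹) ^ r) ?_
    filter_upwards [ae_restrict_mem measurableSet_Ioo] with x hx
    exact norm_qBase_cpow_le ha (by linarith) le_rfl hx
  · exact ((aestronglyMeasurable_qBase_cpow a ξ (r - 1) _).const_mul _).mul
      (by fun_prop : Continuous fun x : ℝ => (a : ℂ) * x * Complex.I).aestronglyMeasurable
  · filter_upwards [ae_restrict_mem measurableSet_Ioo] with x hx η hη
    have hη' : |η| ≤ |ξ| + 1 := by
      have h1 : |η - ξ| < 1 := by simpa [Real.dist_eq] using hη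
      linarith [abs_sub_abs_le_abs_sub η ξ]
    have hb := norm_qBase_cpow_le ha (sub_nonneg.2 hr) hη' hx
    have hx' : |x| ≤ (√a)⁻¹ := (abs_lt.2 hx).le
    have hr0 : 0 ≤ r := by linarith
    simp only [norm_mul, Complex.norm_real, Complex.norm_I, mul_one, Real.norm_eq_abs,
      abs_of_pos ha, abs_of_nonneg hr0]
    gcongr
  · exact integrable_const _
  · filter_upwards [ae_restrict_mem measurableSet_Ioo] with x hx η _
    exact hasDerivAt_qBase_cpow_param (Or.inl (qBase_re_pos η ha hx))

lemma hasDerivAt_Yfun_s11 {q : ℝ} (hq0 : 0 < q) (hq1 : q < 1) (ξ : ℝ) :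
    HasDerivAt (Yfun q) (∫ x in (-(√(1 - q))⁻¹)..(√(1 - q))⁻¹,
      Complex.I * x * qBase (1 - q) ξ x ^ (((1 - q)⁻¹ - 1 : ℝ) : ℂ)) ξ := by
  have ha : 0 < 1 - q := sub_pos.2 hq1
  have h := hasDerivAt_integral_qBase_cpow ha
    ((one_le_inv₀ ha).2 (by linarith) : 1 ≤ (1 - q)⁻¹) ξ
  rw [← funext (Yfun_eq_intervalIntegral hq1)] at h
  refine h.congr_deriv (intervalIntegral.integral_congr fun x _ => ?_)
  have hc : ((((1 - q)⁻¹ : ℝ) : ℂ)) * ((1 - q : ℝ) : ℂ) = 1 := by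
    rw [← Complex.ofReal_mul, inv_mul_cancel₀ ha.ne', Complex.ofReal_one]
  linear_combination (Complex.I * x * qBase (1 - q) ξ x ^ (((1 - q)⁻¹ - 1 : ℝ) : ℂ)) * hc

lemma Yfun_two_sub_inv {q : ℝ} (hq0 : 0 < q) (hq1 : q < 1) (ξ : ℝ) :
    Yfun (2 - 1 / q) (√q * ξ) = √q * ∫ x in (-(√(1 - q))⁻¹)..(√(1 - q))⁻¹,
      qBase (1 - q) ξ x ^ (((1 - q)⁻¹ - 1 : ℝ) : ℂ) := by
  have ha : 0 < 1 - q := sub_pos.2 hq1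
  have hs : 0 < √q := Real.sqrt_pos.2 hq0
  have hsq : √q * √q = q := Real.mul_self_sqrt hq0.le
  have hlt : 2 - 1 / q < 1 := by
    have := (one_lt_div hq0).2 hq1
    linarith
  have h1 : 1 - (2 - 1 / q) = (1 - q) / q := by field_simp; ring
  have h2 : ((1 - q) / q)⁻¹ = (1 - q)⁻¹ - 1 := by field_simp; ring
  have h3 : (√((1 - q) / q))⁻¹ = √q * (√(1 - q))⁻¹ := by
    rw [Real.sqrt_div ha.le, inv_div, div_eq_mul_inv]
  have hbase (x : ℝ) : qBase ((1 - q) / q) (√q * ξ) (√q * x) = qBase (1 - q) ξ x := by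
    apply Complex.ext
    · rw [qBase_re, qBase_re, mul_pow, Real.sq_sqrt hq0.le]
      field_simp
    · rw [qBase_im, qBase_im]
      calc (1 - q) / q * (√q * ξ) * (√q * x) = (1 - q) / q * (√q * √q) * ξ * x := by ring
        _ = (1 - q) * ξ * x := by rw [hsq, div_mul_cancel₀ _ hq0.ne']
  have hscale := intervalIntegral.smul_integral_comp_mul_left (a := -(√(1 - q))⁻¹)
    (b := (√(1 - q))⁻¹) (fun x => qBase ((1 - q) / q) (√q * ξ) x ^ (((1 - q)⁻¹ - 1 : ℝ) : ℂ)) √q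
  simp only [hbase] at hscale
  rw [Yfun_eq_intervalIntegral hlt, h1, h2, h3, ← mul_neg, ← hscale, Complex.real_smul]

lemma ofReal_mul_cpow {c : ℝ} (hc : 0 < c) {z : ℂ} (hz : z ≠ 0) (w : ℂ) :
    ((c : ℂ) * z) ^ w = (c : ℂ) ^ w * z ^ w := by
  have hc' : (c : ℂ) ≠ 0 := Complex.ofReal_ne_zero.2 hc.ne'
  rw [Complex.cpow_def_of_ne_zero (mul_ne_zero hc' hz), Complex.cpow_def_of_ne_zero hc',
    Complex.cpow_def_of_ne_zero hz, Complex.log_ofReal_mul hc hz, Complex.ofReal_log hc.le,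
    add_mul, Complex.exp_add]

/-- The antiderivative evaluation behind the inhomogeneous term. -/
lemma integral_deriv_qBase_cpow {a ξ : ℝ} (ha : 0 < a) (hξ : 0 < ξ) :
    ∫ x in (-(√a)⁻¹)..(√a)⁻¹,
      (ξ + 2 * Complex.I * x) * qBase a ξ x ^ ((a⁻¹ - 1 : ℝ) : ℂ) =
    ((2 * Real.sin (π / 2 * a⁻¹) * (√a * ξ) ^ a⁻¹ : ℝ) : ℂ) := by
  have hs : 0 < √a := Real.sqrt_pos.2 ha
  have hcont : Continuous fun x : ℝ =>
      (ξ + 2 * Complex.I * x) * qBase a ξ x ^ ((a⁻¹ - 1 : ℝ) : ℂ) :=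
    (by fun_prop : Continuous fun x : ℝ => (ξ : ℂ) + 2 * Complex.I * x).mul
      (((continuous_qBase a ξ).cpow continuous_const fun x => qBase_mem_slitPlane x ha hξ))
  have hc : ((a⁻¹ : ℝ) : ℂ) * (a : ℂ) = 1 := by
    rw [← Complex.ofReal_mul, inv_mul_cancel₀ ha.ne', Complex.ofReal_one]
  have hderiv (x : ℝ) : HasDerivAt (fun x => -Complex.I * qBase a ξ x ^ ((a⁻¹ : ℝ) : ℂ))
      ((ξ + 2 * Complex.I * x) * qBase a ξ x ^ ((a⁻¹ - 1 : ℝ) : ℂ)) x := by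
    refine ((hasDerivAt_qBase_cpow (r := a⁻¹)
      (qBase_mem_slitPlane x ha hξ)).const_mul (-Complex.I)).congr_deriv ?_
    linear_combination ((ξ + 2 * Complex.I * x) * qBase a ξ x ^ ((a⁻¹ - 1 : ℝ) : ℂ)) *
      (hc - (((a⁻¹ : ℝ) : ℂ) * (a : ℂ)) * Complex.I_sq)
  rw [intervalIntegral.integral_eq_sub_of_hasDerivAt (fun x _ => hderiv x)
    (hcont.intervalIntegrable _ _)]
  have hpos : 0 < √a * ξ := mul_pos hs hξ
  have hsq : (√a)⁻¹ ^ 2 = a⁻¹ := by rw [inv_pow, Real.sq_sqrt ha.le]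
  have hmul : a * (√a)⁻¹ = √a := by rw [← div_eq_mul_inv, Real.div_sqrt]
  have hright : qBase a ξ (√a)⁻¹ = ((√a * ξ : ℝ) : ℂ) * Complex.I := by
    apply Complex.ext
    · rw [qBase_re, hsq, mul_inv_cancel₀ ha.ne']; simp
    · rw [qBase_im, mul_right_comm, hmul]; simp
  have hleft : qBase a ξ (-(√a)⁻¹) = ((√a * ξ : ℝ) : ℂ) * (-Complex.I) := by
    apply Complex.ext
    · rw [qBase_re, neg_sq, hsq, mul_inv_cancel₀ ha.ne']; simp
    · rw [qBase_im, mul_neg, mul_right_comm, hmul]; simp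
  have hI : Complex.I ^ ((a⁻¹ : ℝ) : ℂ) = Complex.exp ((π / 2 * a⁻¹ : ℝ) * Complex.I) := by
    rw [Complex.cpow_def_of_ne_zero Complex.I_ne_zero, Complex.log_I]
    congr 1; push_cast; ring
  have hnI : (-Complex.I) ^ ((a⁻¹ : ℝ) : ℂ) = Complex.exp (-(π / 2 * a⁻¹ : ℝ) * Complex.I) := by
    rw [Complex.cpow_def_of_ne_zero (neg_ne_zero.2 Complex.I_ne_zero), Complex.log_neg_I]
    congr 1; push_cast; ring
  rw [hright, hleft, ofReal_mul_cpow hpos Complex.I_ne_zero,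
    ofReal_mul_cpow hpos (neg_ne_zero.2 Complex.I_ne_zero), hI, hnI,
    ← Complex.ofReal_cpow hpos.le, Complex.ofReal_mul (2 * _), Complex.ofReal_mul 2,
    Complex.ofReal_sin, Complex.sin, Complex.ofReal_ofNat]
  ring

/-- for `0 < q < 1`, `q ≠ l/(l+1)`, `Y(q,·)` is differentiable and
satisfies `2√q ∂_ξ Y(q,ξ) + ξ Y(2 - 1/q, √q ξ) = r_q ξ^{1/(1-q)}` for `ξ > 0`. -/
theorem Yfun_fde_of_lt_one (q : ℝ) (hq0 : 0 < q) (hq1 : q < 1)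
    (hql : ∀ l : ℕ, 0 < l → q ≠ (l : ℝ) / ((l : ℝ) + 1)) :
    Differentiable ℝ (Yfun q) ∧
    ∀ ξ : ℝ, 0 < ξ →
      ((2 * Real.sqrt q : ℝ) : ℂ) * deriv (Yfun q) ξ +
        (ξ : ℂ) * Yfun (2 - 1 / q) (Real.sqrt q * ξ) =
      (((2 * Real.sqrt q * Real.sin (π / (2 * (1 - q))) *
          (1 - q) ^ (1 / (2 * (1 - q))) : ℝ)) : ℂ) * ((ξ ^ (1 / (1 - q)) : ℝ) : ℂ) := by
  refine ⟨fun ξ => (hasDerivAt_Yfun_s11 hq0 hq1 ξ).differentiableAt, fun ξ hξ => ?_⟩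
  have ha : 0 < 1 - q := sub_pos.2 hq1
  have hcpow : Continuous fun x : ℝ => qBase (1 - q) ξ x ^ (((1 - q)⁻¹ - 1 : ℝ) : ℂ) :=
    (continuous_qBase _ ξ).cpow continuous_const fun x => qBase_mem_slitPlane x ha hξ
  have hlin : Continuous fun x : ℝ =>
      Complex.I * x * qBase (1 - q) ξ x ^ (((1 - q)⁻¹ - 1 : ℝ) : ℂ) :=
    (by fun_prop : Continuous fun x : ℝ => Complex.I * (x : ℂ)).mul hcpow
  have hsum := integral_deriv_qBase_cpow ha hξ
  have hsplit : ∫ x in (-(√(1 - q))⁻¹)..(√(1 - q))⁻¹,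
      ((ξ : ℂ) + 2 * Complex.I * x) * qBase (1 - q) ξ x ^ (((1 - q)⁻¹ - 1 : ℝ) : ℂ) =
      ξ * (∫ x in (-(√(1 - q))⁻¹)..(√(1 - q))⁻¹,
        qBase (1 - q) ξ x ^ (((1 - q)⁻¹ - 1 : ℝ) : ℂ)) +
      2 * ∫ x in (-(√(1 - q))⁻¹)..(√(1 - q))⁻¹,
        Complex.I * x * qBase (1 - q) ξ x ^ (((1 - q)⁻¹ - 1 : ℝ) : ℂ) := by
    rw [← intervalIntegral.integral_const_mul, ← intervalIntegral.integral_const_mul,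
      ← intervalIntegral.integral_add ((hcpow.const_mul _).intervalIntegrable _ _)
        ((hlin.const_mul _).intervalIntegrable _ _)]
    refine intervalIntegral.integral_congr fun x _ => ?_
    ring
  have hpow : (√(1 - q) * ξ) ^ (1 - q)⁻¹ =
      (1 - q) ^ (1 / (2 * (1 - q))) * ξ ^ (1 / (1 - q)) := by
    rw [Real.mul_rpow (Real.sqrt_nonneg _) hξ.le, Real.sqrt_eq_rpow, ← Real.rpow_mul ha.le,
      one_div (1 - q)]
    congr 2
    field_simp
  have hangle : π / 2 * (1 - q)⁻¹ = π / (2 * (1 - q)) := by field_simp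
  rw [hsplit, hpow, hangle] at hsum
  rw [(hasDerivAt_Yfun_s11 hq0 hq1 ξ).deriv, Yfun_two_sub_inv hq0 hq1]
  push_cast at hsum ⊢
  linear_combination (√q : ℂ) * hsum

end
end

section
/- Let 0 < q < 1 with q ≠ m/(m+1) for every positive integer m, and set r_q := 2√q · sin( π/(2(1-q)) ) · (1-q)^{1/(2(1-q))}. Then there exist NO real numbers q̃ < 3 with q̃ ≠ 0, β > 0, β' > 0 and a' > 0 such that the functions Y(ξ) := C_q·e_{q̃}^{-β ξ²} and Z(ξ) := a'·e_{2-1/q̃}^{-β' ξ²} satisfy 2√q·Y'(ξ) + ξ·Z(√q·ξ) = r_q·ξ^{1/(1-q)} for all ξ > 0. That is, the Cauchy problem 2√q·Y'(ξ) + ξ·Y^*(√q·ξ) = r_q·ξ^{1/(1-q)}, Y(0) = C_q, has no solution in the class 𝒢 (with the companion function Y^* taken in 𝒢_{2-1/q̃} when Y ∈ 𝒢_{q̃}). -/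
open MeasureTheory Complex Real Set Filter

noncomputable section

/-- A function analytic at `0` which agrees with a nonzero multiple of `x ^ s` to the right of `0`
forces `s` to be a natural number. -/
theorem AnalyticAt.exists_nat_eq_of_eq_const_mul_rpow {f : ℝ → ℝ} {R s : ℝ}
    (hf : AnalyticAt ℝ f 0) (hR : R ≠ 0) (h : ∀ x : ℝ, 0 < x → f x = R * x ^ s) :
    ∃ n : ℕ, s = n := by
  have hpos : ∀ᶠ x : ℝ in nhdsWithin 0 (Ioi 0), 0 < x := self_mem_nhdsWithin
  have hne : ¬ ∀ᶠ x in nhds 0, f x = 0 := fun h0 => by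
    obtain ⟨x, hx0, hx⟩ := ((h0.filter_mono nhdsWithin_le_nhds).and hpos).exists
    exact mul_ne_zero hR (rpow_pos_of_pos hx s).ne' ((h x hx).symm.trans hx0)
  obtain ⟨n, g, hg, hg0, hfg⟩ := hf.exists_eventuallyEq_pow_smul_nonzero_iff.mpr hne
  have hgt : Tendsto g (nhdsWithin 0 (Ioi 0)) (nhds (g 0)) :=
    hg.continuousAt.tendsto.mono_left nhdsWithin_le_nhds
  have hpow : Tendsto (fun x : ℝ => x ^ (s - n)) (nhdsWithin 0 (Ioi 0)) (nhds (g 0 / R)) := by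
    refine (hgt.div_const R).congr' ?_
    filter_upwards [hfg.filter_mono nhdsWithin_le_nhds, hpos] with x hx hx0
    rw [h x hx0, sub_zero, smul_eq_mul] at hx
    have hxn := (pow_pos hx0 n).ne'
    rw [rpow_sub hx0, rpow_natCast]
    field_simp
    linarith
  refine ⟨n, ?_⟩
  rcases lt_trichotomy s n with hs | hs | hs
  · exact absurd hpow (not_tendsto_nhds_of_tendsto_atTop
      (tendsto_rpow_neg_nhdsGT_zero (sub_neg.mpr hs)) _)
  · exact hs
  · have hzero : Tendsto (fun x : ℝ => x ^ (s - n)) (nhdsWithin 0 (Ioi 0)) (nhds 0) := by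
      have := (continuousAt_rpow_const 0 (s - n) (Or.inr (sub_pos.mpr hs).le)).tendsto
      rw [zero_rpow (sub_pos.mpr hs).ne'] at this
      exact this.mono_left nhdsWithin_le_nhds
    exact absurd (tendsto_nhds_unique hpow hzero) (div_ne_zero hg0 hR)

theorem analyticAt_qExpR_zero (q : ℝ) : AnalyticAt ℝ (qExpR q) 0 := by
  by_cases hq : q = 1
  · have : qExpR q = Real.exp := by
      funext z
      simp [qExpR, hq]
    rw [this]
    exact analyticAt_rexp
  · have hbase : AnalyticAt ℝ (fun z : ℝ => 1 + (1 - q) * z) 0 := by fun_prop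
    have hpos : ∀ᶠ z : ℝ in nhds 0, 0 < 1 + (1 - q) * z :=
      hbase.continuousAt.eventually_const_lt (by simp)
    have hexp : AnalyticAt ℝ
        (fun z : ℝ => Real.exp (Real.log (1 + (1 - q) * z) * (1 / (1 - q)))) 0 :=
      ((hbase.log (by simp)).mul analyticAt_const).rexp'
    refine hexp.congr ?_
    filter_upwards [hpos] with z hz
    rw [qExpR, if_neg hq, if_neg (not_le.mpr hz), rpow_def_of_pos hz]

theorem analyticAt_qExpR_mul_sq (q b c : ℝ) :
    AnalyticAt ℝ (fun s : ℝ => qExpR q (b * (c * s) ^ 2)) 0 := by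
  have hq : AnalyticAt ℝ (qExpR q) (b * (c * 0) ^ 2) := by
    simpa using analyticAt_qExpR_zero q
  exact AnalyticAt.fun_comp (f := fun s : ℝ => b * (c * s) ^ 2) hq (by fun_prop)

/-- for `0 < q < 1` with `q ≠ m/(m+1)`, the Cauchy problem
`2√q Y'(ξ) + ξ Y*(√q ξ) = r_q ξ^{1/(1-q)}`, `Y(0) = C_q`, has no solution with
`Y(ξ) = C_q e_{q̃}^{-βξ²} ∈ 𝒢_{q̃}` and companion `Y*(ξ) = a' e_{2-1/q̃}^{-β'ξ²} ∈ 𝒢_{2-1/q̃}`. -/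
theorem no_solution_in_G_of_lt_one (q : ℝ) (hq0 : 0 < q) (hq1 : q < 1)
    (hqm : ∀ m : ℕ, 0 < m → q ≠ (m : ℝ) / ((m : ℝ) + 1)) :
    ¬ ∃ (qt β β' a' : ℝ), qt < 3 ∧ qt ≠ 0 ∧ 0 < β ∧ 0 < β' ∧ 0 < a' ∧
      ∀ ξ : ℝ, 0 < ξ →
        2 * Real.sqrt q * deriv (fun s : ℝ => Cq q * qExpR qt (-β * s ^ 2)) ξ +
          ξ * (a' * qExpR (2 - 1 / qt) (-β' * (Real.sqrt q * ξ) ^ 2)) =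
        (2 * Real.sqrt q * Real.sin (π / (2 * (1 - q))) *
          (1 - q) ^ (1 / (2 * (1 - q)))) * ξ ^ (1 / (1 - q)) := by
  rintro ⟨qt, β, β', a', -, -, -, -, -, h⟩
  have hq : 0 < 1 - q := sub_pos.mpr hq1
  have hs_nat : ∀ n : ℕ, 1 / (1 - q) ≠ n := by
    intro n hn
    have hn1 : 1 < n := by
      have : (1 : ℝ) < n := by
        rw [← hn, lt_div_iff₀ hq]
        linarith
      exact_mod_cast this
    obtain ⟨m, rfl⟩ : ∃ m, n = m + 1 := ⟨n - 1, by omega⟩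
    refine hqm m (by omega) ?_
    push_cast at hn
    rw [div_eq_iff hq.ne'] at hn
    rw [eq_div_iff (by positivity)]
    linarith
  have hsin : Real.sin (π / (2 * (1 - q))) ≠ 0 := by
    intro h0
    obtain ⟨k, hk⟩ := Real.sin_eq_zero_iff.mp h0
    have hk' : 1 / (1 - q) = ((2 * k : ℤ) : ℝ) := by
      push_cast
      field_simp at hk ⊢
      linarith
    have hk0 : 0 ≤ 2 * k := by
      have : (0 : ℝ) ≤ ((2 * k : ℤ) : ℝ) := hk' ▸ (one_div_pos.mpr hq).le
      exact_mod_cast this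
    obtain ⟨n, hn⟩ := Int.eq_ofNat_of_zero_le hk0
    exact hs_nat n (by rw [hk', hn, Int.cast_natCast])
  have hR : 2 * Real.sqrt q * Real.sin (π / (2 * (1 - q))) *
      (1 - q) ^ (1 / (2 * (1 - q))) ≠ 0 :=
    mul_ne_zero (mul_ne_zero (mul_ne_zero two_ne_zero (Real.sqrt_pos.mpr hq0).ne') hsin)
      (rpow_pos_of_pos hq _).ne'
  have hY : AnalyticAt ℝ (fun s : ℝ => Cq q * qExpR qt (-β * s ^ 2)) 0 := by
    have := analyticAt_qExpR_mul_sq qt (-β) 1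
    simp only [one_mul] at this
    exact analyticAt_const.mul this
  have hZ := analyticAt_qExpR_mul_sq (2 - 1 / qt) (-β') (Real.sqrt q)
  obtain ⟨n, hn⟩ := AnalyticAt.exists_nat_eq_of_eq_const_mul_rpow
    ((analyticAt_const.mul hY.deriv).add (analyticAt_id.mul (analyticAt_const.mul hZ))) hR h
  exact hs_nat n hn

end
end

section
/- Let m ≥ 1 be an integer and q = m/(m+1). Then for all ξ ∈ ℝ, Y(q,ξ) = ∫_{-√(m+1)}^{√(m+1)} ( 1 − x²/(m+1) + i x ξ/(m+1) )^{m+1} dx = Σ_{k=0}^{⌊(m+1)/2⌋} (−1)^k · binom(m+1, 2k) · (m+1)^{1/2 − k} · B(k + 1/2, m − 2k + 2) · ξ^{2k}, where B(a,b) = Γ(a)Γ(b)/Γ(a+b) is the Euler Beta function and ⌊·⌋ is the integer part. -/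
open MeasureTheory Complex Real Set Filter

noncomputable section

/-- The Beta-type recurrence behind `B(a, b + 1) = B(a, b) - B(a + 1, b)`. -/
lemma Gamma_beta_recurrence {a b : ℝ} (ha : 0 < a) (hb : 0 < b) :
    Real.Gamma a * Real.Gamma (b + 1) / Real.Gamma (a + (b + 1)) =
      Real.Gamma a * Real.Gamma b / Real.Gamma (a + b) -
        Real.Gamma (a + 1) * Real.Gamma b / Real.Gamma (a + 1 + b) := by
  have hab : Real.Gamma (a + b) ≠ 0 := (Real.Gamma_pos_of_pos (by positivity)).ne'
  have hab' : a + b ≠ 0 := by positivity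
  rw [show a + (b + 1) = a + b + 1 by ring, show a + 1 + b = a + b + 1 by ring,
    Real.Gamma_add_one ha.ne', Real.Gamma_add_one hb.ne', Real.Gamma_add_one hab']
  field_simp
  ring

lemma integral_even_pow_mul_one_sub_sq_pow {c : ℝ} (hc : 0 < c) (k n : ℕ) :
    ∫ x in (-c)..c, x ^ (2 * k) * (1 - x ^ 2 / c ^ 2) ^ n =
      c ^ (2 * k + 1) * (Real.Gamma (k + 1 / 2) * Real.Gamma (n + 1) /
        Real.Gamma (k + 1 / 2 + (n + 1))) := by
  induction n generalizing k with
  | zero =>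
    have hk : (0 : ℝ) < k + 1 / 2 := by positivity
    have hG : Real.Gamma ((k : ℝ) + 1 / 2) ≠ 0 := (Real.Gamma_pos_of_pos hk).ne'
    have hodd : (-c) ^ (2 * k + 1) = -c ^ (2 * k + 1) := Odd.neg_pow ⟨k, rfl⟩ c
    simp only [pow_zero, mul_one, integral_pow, hodd, Nat.cast_zero, zero_add, Real.Gamma_one,
      Real.Gamma_add_one hk.ne']
    push_cast
    field_simp
    ring
  | succ n ih =>
    have hsplit : ∀ x : ℝ, x ^ (2 * k) * (1 - x ^ 2 / c ^ 2) ^ (n + 1) =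
        x ^ (2 * k) * (1 - x ^ 2 / c ^ 2) ^ n -
          (1 / c ^ 2) * (x ^ (2 * (k + 1)) * (1 - x ^ 2 / c ^ 2) ^ n) := by
      intro x
      ring
    simp only [hsplit]
    rw [intervalIntegral.integral_sub (Continuous.intervalIntegrable (by fun_prop) _ _)
      (Continuous.intervalIntegrable (by fun_prop) _ _), intervalIntegral.integral_const_mul,
      ih k, ih (k + 1)]
    push_cast
    rw [Gamma_beta_recurrence (a := (k : ℝ) + 1 / 2) (b := (n : ℝ) + 1) (by positivity)
      (by positivity), show (k : ℝ) + 1 + 1 / 2 = k + 1 / 2 + 1 by ring]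
    field_simp
    ring

lemma integral_odd_pow_mul_one_sub_sq_pow (c : ℝ) {j : ℕ} (hj : Odd j) (n : ℕ) :
    ∫ x in (-c)..c, x ^ j * (1 - x ^ 2 / c ^ 2) ^ n = 0 := by
  have h := intervalIntegral.integral_comp_neg (a := -c) (b := c)
    (fun x : ℝ => x ^ j * (1 - x ^ 2 / c ^ 2) ^ n)
  simp only [hj.neg_pow, even_two.neg_pow, neg_mul, intervalIntegral.integral_neg, neg_neg] at h
  linarith

lemma sum_range_succ_eq_sum_even {M : Type*} [AddCommMonoid M] (N : ℕ) (f : ℕ → M)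
    (hf : ∀ j, Odd j → f j = 0) :
    ∑ j ∈ Finset.range (N + 1), f j = ∑ k ∈ Finset.range (N / 2 + 1), f (2 * k) := by
  symm
  refine Finset.sum_of_injOn (fun k => 2 * k) (fun a _ b _ h => by simpa using h) ?_ ?_
    (fun _ _ => rfl)
  · intro k hk
    simp only [Finset.coe_range, Set.mem_Iio] at hk ⊢
    omega
  · intro j hj hj'
    refine hf j (Nat.not_even_iff_odd.mp fun ⟨k, hk⟩ => hj' ⟨k, ?_, ?_⟩)
    · simp only [Finset.coe_range, Finset.mem_range, Set.mem_Iio] at hj ⊢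
      omega
    · simp only
      omega

lemma integral_one_sub_sq_add_I_mul_pow {c : ℝ} (hc : 0 < c) (ξ : ℝ) (N : ℕ) :
    ∫ x in (-c)..c, ((1 : ℂ) - (x : ℂ) ^ 2 / (c : ℂ) ^ 2 +
        Complex.I * (x : ℂ) * (ξ : ℂ) / (c : ℂ) ^ 2) ^ N =
      ∑ k ∈ Finset.range (N / 2 + 1),
        (((-1 : ℝ) ^ k * (N.choose (2 * k) : ℝ) * (c / c ^ (2 * k)) *
          (Real.Gamma (k + 1 / 2) * Real.Gamma ((N - 2 * k : ℕ) + 1) /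
            Real.Gamma (k + 1 / 2 + ((N - 2 * k : ℕ) + 1))) * ξ ^ (2 * k) : ℝ) : ℂ) := by
  have hexp : ∀ x : ℝ, ((1 : ℂ) - (x : ℂ) ^ 2 / (c : ℂ) ^ 2 +
        Complex.I * (x : ℂ) * (ξ : ℂ) / (c : ℂ) ^ 2) ^ N =
      ∑ j ∈ Finset.range (N + 1), (Complex.I * ξ / (c : ℂ) ^ 2) ^ j * (N.choose j : ℂ) *
        ((x ^ j * (1 - x ^ 2 / c ^ 2) ^ (N - j) : ℝ) : ℂ) := by
    intro x
    rw [add_comm, add_pow]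
    refine Finset.sum_congr rfl fun j _ => ?_
    push_cast
    rw [show Complex.I * (x : ℂ) * ξ / (c : ℂ) ^ 2 = (Complex.I * ξ / (c : ℂ) ^ 2) * x by ring,
      mul_pow]
    ring
  simp only [hexp]
  rw [intervalIntegral.integral_finsetSum
    (fun j _ => Continuous.intervalIntegrable (by fun_prop) _ _)]
  simp only [intervalIntegral.integral_const_mul, intervalIntegral.integral_ofReal]
  rw [sum_range_succ_eq_sum_even]
  · refine Finset.sum_congr rfl fun k _ => ?_
    have hc' : (c : ℂ) ≠ 0 := by exact_mod_cast hc.ne'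
    rw [integral_even_pow_mul_one_sub_sq_pow hc, div_pow, mul_pow, pow_mul Complex.I, Complex.I_sq]
    push_cast
    field_simp
    ring
  · intro j hj
    rw [integral_odd_pow_mul_one_sub_sq_pow c hj]
    simp

lemma one_sub_nat_div_succ (m : ℕ) : 1 - (m : ℝ) / (m + 1) = ((m : ℝ) + 1)⁻¹ := by
  field_simp
  ring

lemma Yfun_nat_div_succ (m : ℕ) (ξ : ℝ) :
    Yfun ((m : ℝ) / (m + 1)) ξ =
      ∫ x in Set.Ioo (-Real.sqrt ((m : ℝ) + 1)) (Real.sqrt ((m : ℝ) + 1)),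
        ((1 : ℂ) - (x : ℂ) ^ 2 / ((m : ℂ) + 1) +
          Complex.I * (x : ℂ) * (ξ : ℂ) / ((m : ℂ) + 1)) ^ (m + 1) := by
  have hm : (0 : ℝ) < (m : ℝ) + 1 := by positivity
  have hq : (m : ℝ) / (m + 1) < 1 := by
    rw [div_lt_one hm]
    linarith
  have hK : (1 - (m : ℝ) / (m + 1)) ^ (-(1 : ℝ) / 2) = Real.sqrt ((m : ℝ) + 1) := by
    rw [one_sub_nat_div_succ, neg_div, Real.rpow_neg (by positivity), Real.inv_rpow hm.le, inv_inv,
      Real.sqrt_eq_rpow]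
  rw [Yfun, if_pos hq, hK]
  refine setIntegral_congr_fun measurableSet_Ioo fun x hx => ?_
  have hqC : (1 : ℂ) - (((m : ℝ) / (m + 1) : ℝ) : ℂ) = ((m : ℂ) + 1)⁻¹ := by
    rw [← Complex.ofReal_one, ← Complex.ofReal_sub, one_sub_nat_div_succ]
    push_cast
    rfl
  have hbase : (1 : ℂ) + ((m : ℂ) + 1)⁻¹ * (-(x : ℂ) ^ 2 + Complex.I * x * ξ) =
      (1 : ℂ) - (x : ℂ) ^ 2 / ((m : ℂ) + 1) + Complex.I * x * ξ / ((m : ℂ) + 1) := by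
    ring
  have hre : ((1 : ℂ) - (x : ℂ) ^ 2 / ((m : ℂ) + 1) + Complex.I * x * ξ / ((m : ℂ) + 1)).re =
      1 - x ^ 2 / (m + 1) := by
    have : (1 : ℂ) - (x : ℂ) ^ 2 / ((m : ℂ) + 1) + Complex.I * x * ξ / ((m : ℂ) + 1) =
        ((1 - x ^ 2 / (m + 1) : ℝ) : ℂ) + ((x * ξ / (m + 1) : ℝ) : ℂ) * Complex.I := by
      push_cast
      ring
    rw [this, Complex.add_re, Complex.re_ofReal_mul, Complex.ofReal_re, Complex.I_re, mul_zero,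
      add_zero]
  have hpos : 0 < 1 - x ^ 2 / ((m : ℝ) + 1) := by
    rw [sub_pos, div_lt_one hm]
    exact Real.sq_lt.mpr hx
  simp only [qExp]
  rw [if_neg hq.ne, hqC, hbase, if_neg fun h => by rw [hre] at h; linarith [h.2], one_div, inv_inv]
  exact_mod_cast Complex.cpow_natCast _ (m + 1)

/-- explicit polynomial form of `Y(q,ξ)` for `q = m/(m+1)`:
`Y(q,ξ) = ∫_{-√(m+1)}^{√(m+1)} (1 - x²/(m+1) + ixξ/(m+1))^{m+1} dx
       = Σ_{k=0}^{⌊(m+1)/2⌋} (-1)^k C(m+1,2k) (m+1)^{1/2-k} B(k+1/2, m-2k+2) ξ^{2k}`,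
with `B(a,b) = Γ(a)Γ(b)/Γ(a+b)`. -/
theorem Yfun_polynomial_repr (m : ℕ) (hm : 1 ≤ m) (q : ℝ)
    (hq : q = (m : ℝ) / ((m : ℝ) + 1)) (ξ : ℝ) :
    Yfun q ξ =
      (∫ x in Set.Ioo (-Real.sqrt ((m : ℝ) + 1)) (Real.sqrt ((m : ℝ) + 1)),
        ((1 : ℂ) - (x : ℂ) ^ 2 / ((m : ℂ) + 1) +
          Complex.I * (x : ℂ) * (ξ : ℂ) / ((m : ℂ) + 1)) ^ (m + 1)) ∧
    Yfun q ξ =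
      ∑ k ∈ Finset.range ((m + 1) / 2 + 1),
        ((((-1 : ℝ) ^ k * ((m + 1).choose (2 * k) : ℝ) *
            ((m : ℝ) + 1) ^ ((1 : ℝ) / 2 - (k : ℝ)) *
            (Real.Gamma ((k : ℝ) + 1 / 2) * Real.Gamma ((m : ℝ) - 2 * (k : ℝ) + 2) /
              Real.Gamma (((k : ℝ) + 1 / 2) + ((m : ℝ) - 2 * (k : ℝ) + 2))) *
            ξ ^ (2 * k) : ℝ)) : ℂ) := by
  subst hq
  refine ⟨Yfun_nat_div_succ m ξ, ?_⟩
  have hm' : (0 : ℝ) < (m : ℝ) + 1 := by positivity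
  have hc : 0 < Real.sqrt ((m : ℝ) + 1) := Real.sqrt_pos.mpr hm'
  have hsq : ((Real.sqrt ((m : ℝ) + 1) : ℝ) : ℂ) ^ 2 = (m : ℂ) + 1 := by
    exact_mod_cast congrArg Complex.ofReal (Real.sq_sqrt hm'.le)
  have h := integral_one_sub_sq_add_I_mul_pow hc ξ (m + 1)
  rw [hsq] at h
  rw [Yfun_nat_div_succ, ← integral_Ioc_eq_integral_Ioo,
    ← intervalIntegral.integral_of_le (by linarith), h]
  refine Finset.sum_congr rfl fun k hk => ?_
  have hk' : 2 * k ≤ m + 1 := by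
    have := Finset.mem_range.mp hk
    omega
  have hcast : (((m + 1 - 2 * k : ℕ) : ℝ)) + 1 = (m : ℝ) - 2 * k + 2 := by
    push_cast [Nat.cast_sub hk']
    ring
  have hpow : Real.sqrt ((m : ℝ) + 1) / Real.sqrt ((m : ℝ) + 1) ^ (2 * k) =
      ((m : ℝ) + 1) ^ ((1 : ℝ) / 2 - (k : ℝ)) := by
    rw [pow_mul, Real.sq_sqrt hm'.le, Real.rpow_sub hm', Real.rpow_natCast, Real.sqrt_eq_rpow]
  rw [hcast, hpow]

end
end

section
/- Let m ≥ 3 be an integer and q = m/(m+1). Then there exist no ε > 0, q' < 3, a > 0 and β > 0 such that Y(q,ξ) = a·e_{q'}^{-β ξ²} for all ξ with |ξ| < ε. In particular, Y(q,·) = F_q[e_q^{-x²}] does not belong to 𝒢. -/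
open MeasureTheory Complex Real Set Filter

noncomputable section

/-- The moments `∫_{-K}^{K} x^j (1 - x²/ν)^k dx`. -/
def betaMoment (ν K : ℝ) (j k : ℕ) : ℝ := ∫ x in (-K)..K, x ^ j * (1 - x ^ 2 / ν) ^ k

theorem betaMoment_succ (ν K : ℝ) (j k : ℕ) :
    betaMoment ν K j (k + 1) = betaMoment ν K j k - betaMoment ν K (j + 2) k / ν := by
  unfold betaMoment
  rw [← intervalIntegral.integral_div, ← intervalIntegral.integral_sub]
  · congr 1
    ext x
    ring
  · exact Continuous.intervalIntegrable (by fun_prop) _ _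
  · exact Continuous.intervalIntegrable (by fun_prop) _ _

theorem betaMoment_parts {ν K : ℝ} (hν : 0 < ν) (hK : K ^ 2 = ν) (j k : ℕ) :
    (j + 1) * betaMoment ν K j (k + 1) = 2 * (k + 1) / ν * betaMoment ν K (j + 2) k := by
  have hderiv : ∀ x : ℝ, HasDerivAt (fun x : ℝ => x ^ (j + 1) * (1 - x ^ 2 / ν) ^ (k + 1))
      ((j + 1) * (x ^ j * (1 - x ^ 2 / ν) ^ (k + 1))
        - 2 * (k + 1) / ν * (x ^ (j + 2) * (1 - x ^ 2 / ν) ^ k)) x := by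
    intro x
    have h1 := (hasDerivAt_id x).fun_pow (j + 1)
    have h2 := ((((hasDerivAt_id x).fun_pow 2).div_const ν).const_sub 1).fun_pow (k + 1)
    refine (h1.fun_mul h2).congr_deriv ?_
    simp only [id, Nat.add_sub_cancel]
    push_cast
    ring
  have h := intervalIntegral.integral_eq_sub_of_hasDerivAt (a := -K) (b := K)
    (fun x _ => hderiv x) (Continuous.intervalIntegrable (by fun_prop) _ _)
  rw [intervalIntegral.integral_sub (Continuous.intervalIntegrable (by fun_prop) _ _)
    (Continuous.intervalIntegrable (by fun_prop) _ _), intervalIntegral.integral_const_mul,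
    intervalIntegral.integral_const_mul, neg_sq, hK, div_self hν.ne'] at h
  simp only [sub_self, ne_eq, Nat.add_eq_zero_iff, one_ne_zero, and_false, not_false_eq_true,
    zero_pow, mul_zero] at h
  unfold betaMoment
  linarith

theorem betaMoment_recurrence {ν K : ℝ} (hν : 0 < ν) (hK : K ^ 2 = ν) (j k : ℕ) :
    (j + 2 * k + 3) * betaMoment ν K j (k + 1) = 2 * (k + 1) * betaMoment ν K j k := by
  have h1 := betaMoment_parts hν hK j k
  have h2 := betaMoment_succ ν K j k
  have h3 : betaMoment ν K (j + 2) k / ν = betaMoment ν K j k - betaMoment ν K j (k + 1) := by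
    linarith
  rw [div_mul_eq_mul_div, mul_div_assoc, h3] at h1
  linarith

theorem betaMoment_pos {ν K : ℝ} (hK0 : 0 < K) (hK : K ^ 2 = ν) {j : ℕ} (hj : Even j)
    (k : ℕ) : 0 < betaMoment ν K j k := by
  have hν : 0 < ν := hK ▸ pow_pos hK0 2
  have hnonneg : ∀ x ∈ Set.Ioc (-K) K, 0 ≤ x ^ j * (1 - x ^ 2 / ν) ^ k := by
    intro x hx
    refine mul_nonneg (hj.pow_nonneg x) (pow_nonneg ?_ k)
    rw [sub_nonneg, div_le_one hν, ← hK]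
    exact sq_le_sq' hx.1.le hx.2
  refine intervalIntegral.integral_pos (by linarith)
    (Continuous.continuousOn (by fun_prop)) hnonneg ⟨K / 2, ⟨by linarith, by linarith⟩, ?_⟩
  have : 0 < 1 - (K / 2) ^ 2 / ν := by
    rw [sub_pos, div_lt_one hν, ← hK]
    nlinarith
  positivity

/-- The polynomial `∫_{-K}^{K} (1 - x²/n + i x X/n)^n dx`. -/
def momentPoly (n : ℕ) (K : ℝ) : Polynomial ℂ :=
  ∑ j ∈ Finset.range (n + 1),
    Polynomial.C ((n.choose j : ℂ) * (Complex.I / n) ^ j * (betaMoment n K j (n - j) : ℂ))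
      * Polynomial.X ^ j

theorem momentPoly_coeff {n j : ℕ} (K : ℝ) (hj : j ≤ n) : (momentPoly n K).coeff j =
    (n.choose j : ℂ) * (Complex.I / n) ^ j * (betaMoment n K j (n - j) : ℂ) := by
  unfold momentPoly
  simp only [Polynomial.finsetSum_coeff, Polynomial.coeff_C_mul_X_pow]
  rw [Finset.sum_ite_eq, if_pos (Finset.mem_range.2 (by lia))]

theorem momentPoly_natDegree_le (n : ℕ) (K : ℝ) : (momentPoly n K).natDegree ≤ n := by
  refine Polynomial.natDegree_sum_le_of_forall_le _ _ fun j hj => ?_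
  exact (Polynomial.natDegree_C_mul_X_pow_le _ _).trans
    (Nat.lt_succ_iff.1 (Finset.mem_range.1 hj))

theorem momentPoly_eval (n : ℕ) (K ξ : ℝ) : (momentPoly n K).eval (ξ : ℂ) =
    ∫ x in (-K)..K, (1 - (x : ℂ) ^ 2 / n + Complex.I * x * ξ / n) ^ n := by
  have hexp : ∀ x : ℝ, (1 - (x : ℂ) ^ 2 / n + Complex.I * x * ξ / n) ^ n =
      ∑ j ∈ Finset.range (n + 1), ((n.choose j : ℂ) * (Complex.I / n) ^ j * (ξ : ℂ) ^ j) *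
        ((x ^ j * (1 - x ^ 2 / n) ^ (n - j) : ℝ) : ℂ) := by
    intro x
    rw [add_comm, add_pow]
    refine Finset.sum_congr rfl fun j _ => ?_
    push_cast
    ring
  simp_rw [hexp]
  rw [intervalIntegral.integral_finsetSum
    fun j _ => Continuous.intervalIntegrable (by fun_prop) _ _]
  unfold momentPoly
  rw [Polynomial.eval_finsetSum]
  refine Finset.sum_congr rfl fun j _ => ?_
  rw [intervalIntegral.integral_const_mul, intervalIntegral.integral_ofReal]
  simp only [Polynomial.eval_mul, Polynomial.eval_C, Polynomial.eval_pow, Polynomial.eval_X,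
    betaMoment]
  ring

/-- For `q = 1 - 1/n`, `Y(q,·)` is a polynomial function. -/
theorem Yfun_eq_momentPoly_eval {n : ℕ} (hn : 0 < n) {q : ℝ} (hq : 1 - q = (n : ℝ)⁻¹) (ξ : ℝ) :
    Yfun q ξ = (momentPoly n (√n)).eval (ξ : ℂ) := by
  have hn0 : (0 : ℝ) < n := by exact_mod_cast hn
  have hnC : (n : ℂ) ≠ 0 := by exact_mod_cast hn.ne'
  have hinv : (0 : ℝ) < (n : ℝ)⁻¹ := inv_pos.2 hn0
  have hqC : (1 : ℂ) - q = (n : ℂ)⁻¹ := by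
    rw [← Complex.ofReal_one, ← Complex.ofReal_sub, hq, Complex.ofReal_inv, Complex.ofReal_natCast]
  have hK : (1 - q) ^ (-(1 : ℝ) / 2) = √n := by
    rw [hq, Real.inv_rpow hn0.le, ← Real.rpow_neg hn0.le, Real.sqrt_eq_rpow]
    norm_num
  rw [Yfun, if_pos (by linarith), hK, momentPoly_eval,
    intervalIntegral.integral_of_le (by linarith [Real.sqrt_nonneg (n : ℝ)]),
    integral_Ioc_eq_integral_Ioo]
  refine setIntegral_congr_fun measurableSet_Ioo fun x hx => ?_
  have hbase : 1 + (1 - (q : ℂ)) * (-(x : ℂ) ^ 2 + Complex.I * (x : ℂ) * (ξ : ℂ)) =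
      1 - (x : ℂ) ^ 2 / n + Complex.I * x * ξ / n := by
    rw [hqC]
    ring
  have hre : 0 < (1 - (x : ℂ) ^ 2 / n + Complex.I * x * ξ / n).re := by
    have hsplit : 1 - (x : ℂ) ^ 2 / n + Complex.I * x * ξ / n =
        ((1 - x ^ 2 / n : ℝ) : ℂ) + ((x * ξ / n : ℝ) : ℂ) * Complex.I := by
      push_cast
      ring
    rw [hsplit, Complex.add_re, Complex.ofReal_re, Complex.re_ofReal_mul, Complex.I_re, mul_zero,
      add_zero, sub_pos, div_lt_one hn0, ← Real.sq_sqrt hn0.le]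
    exact sq_lt_sq' hx.1 hx.2
  simp only [qExp]
  rw [if_neg (by linarith), hbase, if_neg (fun h => absurd h.2 (not_le.2 hre)), hqC, one_div,
    inv_inv, Complex.cpow_natCast]

/-- The `q`-Gaussian solves `(1 - (1-q)βξ²) g' = -2βξ g` where it is positive. -/
theorem hasDerivAt_qExpR_sq {q β ξ : ℝ} (h : 0 < 1 - (1 - q) * β * ξ ^ 2) :
    HasDerivAt (fun ξ : ℝ => qExpR q (-β * ξ ^ 2))
      (-2 * β * ξ * qExpR q (-β * ξ ^ 2) / (1 - (1 - q) * β * ξ ^ 2)) ξ := by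
  have hsq : ∀ b : ℝ, HasDerivAt (fun ξ : ℝ => b * ξ ^ 2) (b * (2 * ξ)) ξ := fun b => by
    simpa using ((hasDerivAt_id ξ).fun_pow 2).const_mul b
  by_cases hq : q = 1
  · subst hq
    simp only [qExpR, if_true]
    refine (hsq (-β)).exp.congr_deriv ?_
    simp only [sub_self, zero_mul, sub_zero, div_one]
    ring
  · have hq' : 1 - q ≠ 0 := sub_ne_zero.2 (Ne.symm hq)
    have hpos : ∀ η : ℝ, 0 < 1 - (1 - q) * β * η ^ 2 →
        qExpR q (-β * η ^ 2) = (1 - (1 - q) * β * η ^ 2) ^ (1 / (1 - q)) := by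
      intro η hη
      have e : 1 + (1 - q) * (-β * η ^ 2) = 1 - (1 - q) * β * η ^ 2 := by ring
      rw [qExpR, if_neg hq, e, if_neg (not_le.2 hη)]
    have hd := ((hsq ((1 - q) * β)).const_sub 1).rpow_const (p := 1 / (1 - q)) (Or.inl h.ne')
    have hev : ∀ᶠ η in nhds ξ, 0 < 1 - (1 - q) * β * η ^ 2 :=
      (show ContinuousAt (fun η : ℝ => 1 - (1 - q) * β * η ^ 2) ξ by fun_prop).eventually_const_lt h
    refine (hd.congr_of_eventuallyEq (hev.mono hpos)).congr_deriv ?_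
    rw [hpos ξ h, Real.rpow_sub_one h.ne']
    field_simp

open Polynomial in
/-- A polynomial agreeing near `0` with a `q`-Gaussian satisfies the same differential equation. -/
theorem polynomial_ode_of_eq_qExpR {P : ℂ[X]} {ε q a β : ℝ} (hε : 0 < ε)
    (h : ∀ ξ : ℝ, |ξ| < ε → P.eval (ξ : ℂ) = ((a * qExpR q (-β * ξ ^ 2) : ℝ) : ℂ)) :
    derivative P * (1 - C (((1 - q) * β : ℝ) : ℂ) * X ^ 2) + C ((2 * β : ℝ) : ℂ) * (P * X) = 0 := by
  have hev1 : ∀ᶠ ξ : ℝ in nhds 0, 0 < 1 - (1 - q) * β * ξ ^ 2 :=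
    (show ContinuousAt (fun η : ℝ => 1 - (1 - q) * β * η ^ 2) 0 by fun_prop).eventually_const_lt
      (by simp)
  have hev2 : ∀ᶠ ξ : ℝ in nhds 0, |ξ| < ε :=
    continuous_abs.continuousAt.eventually_lt_const (by simpa using hε)
  obtain ⟨δ, hδ, hball⟩ := Metric.eventually_nhds_iff.1 (hev1.and hev2)
  refine Polynomial.eq_zero_of_infinite_isRoot _ (Set.Infinite.mono ?_
    ((Set.Ioo_infinite hδ).image (Complex.ofReal_injective.injOn)))
  rintro _ ⟨ξ, hξ, rfl⟩
  obtain ⟨hpos, hlt⟩ := hball (y := ξ) (by simpa [abs_of_pos hξ.1] using hξ.2)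
  have hd1 : HasDerivAt (fun ξ : ℝ => P.eval (ξ : ℂ)) ((derivative P).eval (ξ : ℂ)) ξ :=
    (P.hasDerivAt (ξ : ℂ)).comp_ofReal
  have hd2 := ((hasDerivAt_qExpR_sq hpos).const_mul a).ofReal_comp
  have hnear : ∀ᶠ η : ℝ in nhds ξ, |η| < ε :=
    continuous_abs.continuousAt.eventually_lt_const hlt
  have heq := hd1.unique (hd2.congr_of_eventuallyEq (hnear.mono h))
  have hposC : (1 : ℂ) - (1 - q) * β * ξ ^ 2 ≠ 0 := by exact_mod_cast hpos.ne'
  simp only [Set.mem_ofPred_eq, IsRoot.def, eval_add, eval_mul, eval_sub, eval_one, eval_C, eval_pow,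
    eval_X, heq, h ξ hlt]
  push_cast
  rw [mul_div_assoc', div_mul_cancel₀ _ hposC]
  ring

open Polynomial in
theorem coeff_recurrence_of_ode {P : ℂ[X]} {c b : ℂ}
    (h : derivative P * (1 - C c * X ^ 2) + C b * (P * X) = 0) :
    2 * P.coeff 2 + b * P.coeff 0 = 0 ∧
      ∀ k : ℕ, (k + 3) * P.coeff (k + 3) = (c * (k + 1) - b) * P.coeff (k + 1) := by
  have h' : derivative P - C c * (derivative P * X ^ 2) + C b * (P * X) = 0 := by
    rw [← h]
    ring
  constructor
  · have h1 := congrArg (fun Q => Q.coeff 1) h'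
    simp only [coeff_add, coeff_sub, coeff_C_mul, coeff_mul_X_pow', coeff_derivative,
      coeff_zero] at h1
    have hX : (P * X).coeff 1 = P.coeff 0 := coeff_mul_X P 0
    norm_num [hX] at h1
    linear_combination h1
  · intro k
    have h1 := congrArg (fun Q => Q.coeff (k + 2)) h'
    have hX : (P * X).coeff (k + 2) = P.coeff (k + 1) := coeff_mul_X P (k + 1)
    simp only [coeff_add, coeff_sub, coeff_C_mul, coeff_mul_X_pow, coeff_derivative,
      coeff_zero, hX] at h1
    push_cast at h1
    linear_combination h1

open Polynomial in
theorem natDegree_mul_eq_of_ode {P : ℂ[X]} {c b : ℂ}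
    (h : derivative P * (1 - C c * X ^ 2) + C b * (P * X) = 0) (hP : 0 < P.natDegree) :
    c * P.natDegree = b := by
  obtain ⟨k, hk⟩ := Nat.exists_eq_add_of_lt hP
  rw [zero_add] at hk
  have hrec := (coeff_recurrence_of_ode h).2 k
  rw [coeff_eq_zero_of_natDegree_lt (by lia : P.natDegree < k + 3), mul_zero] at hrec
  have hlead : P.coeff (k + 1) ≠ 0 := by
    rw [← hk]
    exact leadingCoeff_ne_zero.2 (ne_zero_of_natDegree_gt hP)
  rw [hk]
  push_cast
  exact sub_eq_zero.1 ((mul_eq_zero.1 hrec.symm).resolve_right hlead)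

theorem momentPoly_coeff_two {n : ℕ} (hn : 4 ≤ n) {K : ℝ} (hK : K ^ 2 = n) :
    8 * (n : ℂ) * (momentPoly n K).coeff 2 = -(2 * n + 1) * (momentPoly n K).coeff 0 := by
  obtain ⟨r, rfl⟩ := Nat.exists_eq_add_of_le' hn
  have hν : (0 : ℝ) < ((r + 4 : ℕ) : ℝ) := by positivity
  have h1 := betaMoment_parts hν hK 0 (r + 3)
  have h2 := betaMoment_recurrence hν hK 2 (r + 2)
  have hC : ((r + 4 : ℕ) : ℂ) ≠ 0 := by exact_mod_cast hν.ne'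
  rw [momentPoly_coeff K (by lia : 2 ≤ r + 4), momentPoly_coeff K (by lia : 0 ≤ r + 4),
    div_pow, Complex.I_sq, Nat.cast_choose_two, show r + 4 - 2 = r + 2 by lia]
  simp only [Nat.sub_zero, Nat.choose_zero_right, Nat.cast_one, pow_zero, mul_one, one_mul]
  generalize betaMoment ((r + 4 : ℕ) : ℝ) K 2 (r + 2) = A at *
  generalize betaMoment ((r + 4 : ℕ) : ℝ) K 2 (r + 2 + 1) = B at *
  generalize betaMoment ((r + 4 : ℕ) : ℝ) K 0 (r + 4) = D at *
  have h3 : D = 2 * B := by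
    push_cast at h1 hν
    field_simp at h1
    simp only [zero_add] at h1
    nlinarith
  have h2C := congrArg (fun r : ℝ => (r : ℂ)) h2
  rw [h3]
  push_cast at h2C hC ⊢
  field_simp
  linear_combination 4 * h2C

theorem momentPoly_coeff_four {n : ℕ} (hn : 4 ≤ n) {K : ℝ} (hK : K ^ 2 = n) :
    16 * (n : ℂ) * (momentPoly n K).coeff 4 = -(2 * n - 1) * (momentPoly n K).coeff 2 := by
  obtain ⟨r, rfl⟩ := Nat.exists_eq_add_of_le' hn
  have hν : (0 : ℝ) < ((r + 4 : ℕ) : ℝ) := by positivity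
  have h1 := betaMoment_parts hν hK 2 (r + 1)
  have h2 := betaMoment_recurrence hν hK 4 r
  have hC : ((r + 4 : ℕ) : ℂ) ≠ 0 := by exact_mod_cast hν.ne'
  have hchoose : 24 * ((r + 4).choose 4 : ℂ) = (r + 4) * (r + 3) * (r + 2) * (r + 1) := by
    have hnat : 24 * (r + 4).choose 4 = (r + 4) * (r + 3) * (r + 2) * (r + 1) := by
      rw [show 24 = Nat.factorial 4 by rfl, ← Nat.descFactorial_eq_factorial_mul_choose]
      simp only [Nat.descFactorial, Nat.reduceSubDiff, Nat.sub_zero, mul_one]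
      ring
    exact_mod_cast hnat
  rw [momentPoly_coeff K (by lia : 2 ≤ r + 4), momentPoly_coeff K (by lia : 4 ≤ r + 4),
    div_pow, div_pow, Complex.I_sq, Complex.I_pow_four, Nat.cast_choose_two,
    show r + 4 - 2 = r + 2 by lia, show r + 4 - 4 = r by lia]
  generalize betaMoment ((r + 4 : ℕ) : ℝ) K 2 (r + 2) = A at *
  generalize betaMoment ((r + 4 : ℕ) : ℝ) K 4 (r + 1) = E at *
  generalize betaMoment ((r + 4 : ℕ) : ℝ) K 4 r = F at *
  have h1C := congrArg (fun r : ℝ => (r : ℂ)) h1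
  have h2C := congrArg (fun r : ℝ => (r : ℂ)) h2
  push_cast at h1C h2C hC ⊢
  rw [div_mul_eq_mul_div, eq_div_iff hC] at h1C
  field_simp
  linear_combination (4 / 3 : ℂ) * F * hchoose
    - (2 / 3 : ℂ) * (r + 4) * (r + 3) * (r + 2) * h2C
    - (1 / 3 : ℂ) * (r + 4) * (r + 3) * (2 * r + 7) * h1C

/-- for `q = m/(m+1)` with `m ≥ 3`, `Y(q,·)` does not coincide with any
multiple of a `q'`-Gaussian `a e_{q'}^{-βξ²}` on any neighbourhood of `0`; in
particular `Y(q,·) ∉ 𝒢`. -/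
theorem Yfun_not_in_G (m : ℕ) (hm : 3 ≤ m) (q : ℝ) (hq : q = (m : ℝ) / ((m : ℝ) + 1)) :
    ¬ ∃ (ε q' a β : ℝ), 0 < ε ∧ q' < 3 ∧ 0 < a ∧ 0 < β ∧
      ∀ ξ : ℝ, |ξ| < ε → Yfun q ξ = ((a * qExpR q' (-β * ξ ^ 2) : ℝ) : ℂ) := by
  rintro ⟨ε, q', a, β, hε, -, -, -, h⟩
  have hn0 : (0 : ℝ) < ((m + 1 : ℕ) : ℝ) := by positivity
  have hq1 : 1 - q = ((m + 1 : ℕ) : ℝ)⁻¹ := by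
    rw [hq]
    push_cast
    field_simp
    ring
  have hK0 : 0 < √((m + 1 : ℕ) : ℝ) := Real.sqrt_pos.2 hn0
  have hK : √((m + 1 : ℕ) : ℝ) ^ 2 = ((m + 1 : ℕ) : ℝ) := Real.sq_sqrt hn0.le
  have hode := polynomial_ode_of_eq_qExpR (P := momentPoly (m + 1) √((m + 1 : ℕ) : ℝ)) hε
    fun ξ hξ => (Yfun_eq_momentPoly_eval m.succ_pos hq1 ξ).symm.trans (h ξ hξ)
  have hle := momentPoly_natDegree_le (m + 1) √((m + 1 : ℕ) : ℝ)
  have h2 := momentPoly_coeff_two (by lia : 4 ≤ m + 1) hK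
  have h4 := momentPoly_coeff_four (by lia : 4 ≤ m + 1) hK
  have hc4 : (momentPoly (m + 1) √((m + 1 : ℕ) : ℝ)).coeff 4 ≠ 0 := by
    rw [momentPoly_coeff _ (by lia)]
    have hch : ((m + 1).choose 4 : ℂ) ≠ 0 := by
      exact_mod_cast (Nat.choose_pos (by lia : 4 ≤ m + 1)).ne'
    have hpos := (betaMoment_pos hK0 hK (j := 4) (by decide) (m + 1 - 4)).ne'
    have hnC : ((m + 1 : ℕ) : ℂ) ≠ 0 := by exact_mod_cast hn0.ne'
    exact mul_ne_zero (mul_ne_zero hch (pow_ne_zero _ (div_ne_zero Complex.I_ne_zero hnC)))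
      (Complex.ofReal_ne_zero.2 hpos)
  generalize momentPoly (m + 1) √((m + 1 : ℕ) : ℝ) = P at *
  have hdeg : 0 < P.natDegree := by
    have := Polynomial.le_natDegree_of_ne_zero hc4
    lia
  have hlead := natDegree_mul_eq_of_ode hode hdeg
  obtain ⟨e0, erec⟩ := coeff_recurrence_of_ode hode
  have e1 := erec 1
  generalize (((1 - q') * β : ℝ) : ℂ) = c at *
  generalize ((2 * β : ℝ) : ℂ) = b at *
  norm_num at e1 h2 h4
  have hnC : ((m : ℂ) + 1) ≠ 0 := by exact_mod_cast m.succ_ne_zero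
  have hc2 : P.coeff 2 ≠ 0 := by
    intro h0
    rw [h0, mul_zero] at h4
    exact hc4 (by simpa [hnC] using h4)
  have hc0 : P.coeff 0 ≠ 0 := by
    intro h0
    rw [h0, mul_zero] at h2
    exact hc2 (by simpa [hnC] using h2)
  have hb : 4 * ((m : ℂ) + 1) * b = 2 * (m + 1) + 1 :=
    mul_right_cancel₀ hc0 (by linear_combination 4 * ((m : ℂ) + 1) * e0 - h2)
  have hc : 4 * ((m : ℂ) + 1) * c = 1 :=
    mul_right_cancel₀ hc2 (by
      linear_combination (1 / 2 : ℂ) * hb * P.coeff 2 + (1 / 2 : ℂ) * h4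
        - 2 * ((m : ℂ) + 1) * e1)
  have hM : (P.natDegree : ℂ) = 2 * (m + 1) + 1 := by
    linear_combination 4 * ((m : ℂ) + 1) * hlead + hb - (P.natDegree : ℂ) * hc
  have hM' : P.natDegree = 2 * (m + 1) + 1 := by exact_mod_cast hM
  lia

end
end
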